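/- arXiv:2604.03722 — 2 statements merged into one kernel-verified Lean document; each statement's English description precedes it below -/
import Mathlib

section
/- Consider the physical fractional Brownian motion model with Hurst parameter H ∈ (0,1/2), noise intensity σ > 0, scale-separation parameter ε > 0 and fixed horizon T > 0. There exists a constant C > 0, depending only on H, T and σ, such that for every ε > 0 and every N ∈ ℕ, with δ = T/N, the estimator satisfies (E[(σ̂²_{ε,δ} − σ²)²])^{1/2} ≤ C(ε^{2H}/δ + ε^{H}/δ^{1−H} + δ^{1/2}). -/
open MeasureTheory ProbabilityTheory Filter Matrix Topology

noncomputable section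

/-- Covariance function of two-sided fractional Brownian motion with Hurst parameter `H`. -/
def fbmCov (H s t : ℝ) : ℝ :=
  (|s| ^ (2 * H) + |t| ^ (2 * H) - |s - t| ^ (2 * H)) / 2

/-- `B` is a two-sided fractional Brownian motion with Hurst parameter `H`:
a.s. continuous paths, `B 0 = 0`, and all finite-dimensional marginals are centered
Gaussian with covariance `fbmCov H`. -/
structure IsTwoSidedFBM {Ω : Type*} [MeasureSpace Ω] (H : ℝ) (B : ℝ → Ω → ℝ) : Prop where
  meas : ∀ t, Measurable (B t)
  cont : ∀ᵐ ω : Ω, Continuous fun t => B t ω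
  zero : ∀ᵐ ω : Ω, B 0 ω = 0
  gaussian : ∀ (n : ℕ) (t a : Fin n → ℝ),
    Measure.map (fun ω => ∑ i, a i * B (t i) ω) (ℙ : Measure Ω)
      = gaussianReal 0 (∑ i, ∑ j, a i * a j * fbmCov H (t i) (t j)).toNNReal

/-- The stationary fractional Ornstein–Uhlenbeck process
`Y^ε_t = (σ/ε^H)(B^H_t − (1/ε)∫_{−∞}^t e^{−(t−s)/ε} B^H_s ds)`. -/
def fracOU {Ω : Type*} [MeasureSpace Ω] (H σ ε : ℝ) (B : ℝ → Ω → ℝ) (t : ℝ) (ω : Ω) : ℝ :=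
  (σ / ε ^ H) * (B t ω - (1 / ε) * ∫ s in Set.Iic t, Real.exp (-(t - s) / ε) * B s ω)

/-- The slow component `X^ε_t = ε^{H−1} ∫_0^t Y^ε_s ds` of the physical fractional
Brownian motion model. -/
def slowX {Ω : Type*} [MeasureSpace Ω] (H σ ε : ℝ) (B : ℝ → Ω → ℝ) (t : ℝ) (ω : Ω) : ℝ :=
  ε ^ (H - 1) * ∫ s in (0 : ℝ)..t, fracOU H σ ε B s ω

/-- Covariance matrix of the increments, over a grid of mesh `δ`, of fractional Brownian
motion with Hurst parameter `H`. -/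
def SigmaH (H δ : ℝ) (N : ℕ) : Matrix (Fin N) (Fin N) ℝ := fun i j =>
  δ ^ (2 * H) / 2 *
    (|(i : ℝ) - (j : ℝ) + 1| ^ (2 * H) + |(i : ℝ) - (j : ℝ) - 1| ^ (2 * H)
      - 2 * |(i : ℝ) - (j : ℝ)| ^ (2 * H))

/-- Vector of increments of the slow component over the grid of mesh `δ`. -/
def incVec {Ω : Type*} [MeasureSpace Ω] (H σ ε δ : ℝ) (B : ℝ → Ω → ℝ) (N : ℕ) (ω : Ω) :
    Fin N → ℝ := fun k =>
  slowX H σ ε B (((k : ℕ) + 1 : ℝ) * δ) ω - slowX H σ ε B ((k : ℕ) * δ) ω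

/-- The maximum-likelihood-type estimator
`σ̂²_{ε,δ} = (1/N) Vᵀ (Σ^H_{δ,N})⁻¹ V`. -/
def sigmaHat2 {Ω : Type*} [MeasureSpace Ω] (H σ ε δ : ℝ) (B : ℝ → Ω → ℝ) (N : ℕ) (ω : Ω) : ℝ :=
  (1 / (N : ℝ)) * (incVec H σ ε δ B N ω ⬝ᵥ ((SigmaH H δ N)⁻¹ *ᵥ incVec H σ ε δ B N ω))

theorem sum_sq_le_quadForm_of_offDiag_nonpos {ι : Type*} [Fintype ι] [DecidableEq ι]
    (M : Matrix ι ι ℝ) (hsymm : ∀ i j, M i j = M j i) (hoff : ∀ i j, i ≠ j → M i j ≤ 0)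
    (c : ℝ) (hrow : ∀ i, c ≤ ∑ j, M i j) (a : ι → ℝ) :
    c * ∑ i, a i ^ 2 ≤ ∑ i, ∑ j, a i * a j * M i j := by
  have h1 : ∑ i, ∑ j, (a i ^ 2 + a j ^ 2) / 2 * M i j ≤ ∑ i, ∑ j, a i * a j * M i j := by
    refine Finset.sum_le_sum fun i _ => Finset.sum_le_sum fun j _ => ?_
    by_cases hij : i = j
    · subst hij
      apply le_of_eq
      ring
    · nlinarith [hoff i j hij, sq_nonneg (a i - a j)]
  have h2 : ∑ i, ∑ j, (a i ^ 2 + a j ^ 2) / 2 * M i j = ∑ i, a i ^ 2 * ∑ j, M i j := by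
    have h3 : ∑ i, ∑ j, a j ^ 2 * M i j = ∑ i, ∑ j, a i ^ 2 * M i j := by
      rw [Finset.sum_comm]
      exact Finset.sum_congr rfl fun i _ => Finset.sum_congr rfl fun j _ => by rw [hsymm]
    have h4 : ∀ i j, (a i ^ 2 + a j ^ 2) / 2 * M i j
        = 1 / 2 * (a i ^ 2 * M i j) + 1 / 2 * (a j ^ 2 * M i j) := fun i j => by ring
    simp only [h4, Finset.sum_add_distrib, ← Finset.mul_sum] at h3 ⊢
    rw [h3]
    ring
  rw [h2] at h1
  refine le_trans ?_ h1
  rw [Finset.mul_sum]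
  exact Finset.sum_le_sum fun i _ => by nlinarith [hrow i, sq_nonneg (a i)]

theorem rpow_second_difference_nonpos {p x : ℝ} (hp0 : 0 ≤ p) (hp1 : p ≤ 1) (hx : 1 ≤ |x|) :
    |x + 1| ^ p + |x - 1| ^ p - 2 * |x| ^ p ≤ 0 := by
  have key : ∀ y : ℝ, 1 ≤ y → (y + 1) ^ p + (y - 1) ^ p - 2 * y ^ p ≤ 0 := by
    intro y hy
    have h := (Real.concaveOn_rpow hp0 hp1).2 (Set.mem_Ici.2 (by linarith : 0 ≤ y + 1))
      (Set.mem_Ici.2 (by linarith : 0 ≤ y - 1)) (by norm_num : (0 : ℝ) ≤ 1 / 2)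
      (by norm_num : (0 : ℝ) ≤ 1 / 2) (by norm_num)
    simp only [smul_eq_mul] at h
    rw [show 1 / 2 * (y + 1) + 1 / 2 * (y - 1) = y by ring] at h
    linarith
  rcases le_abs.1 hx with h | h
  · rw [abs_of_nonneg (by linarith : 0 ≤ x + 1), abs_of_nonneg (by linarith : 0 ≤ x - 1),
      abs_of_nonneg (by linarith : 0 ≤ x)]
    exact key x h
  · rw [abs_of_nonpos (by linarith : x + 1 ≤ 0), abs_of_nonpos (by linarith : x - 1 ≤ 0),
      abs_of_nonpos (by linarith : x ≤ 0)]
    have := key (-x) h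
    rw [show -(x + 1) = -x - 1 by ring, show -(x - 1) = -x + 1 by ring]
    linarith

theorem mul_rpow_le_rpow_sub_rpow {p m n : ℝ} (hp0 : 0 ≤ p) (hp1 : p ≤ 1) (hm : 1 ≤ m)
    (hmn : m ≤ n) : p * n ^ (p - 1) ≤ m ^ p - (m - 1) ^ p := by
  have hm0 : 0 < m := by linarith
  have h1 : (m - 1) ^ p ≤ m ^ p * (1 - p / m) := by
    have h := rpow_one_add_le_one_add_mul_self (s := -1 / m)
      (by rw [le_div_iff₀ hm0]; linarith) hp0 hp1
    have h2 : m - 1 = m * (1 + -1 / m) := by field_simp; ring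
    rw [h2, Real.mul_rpow hm0.le]
    · refine mul_le_mul_of_nonneg_left (h.trans_eq ?_) (by positivity)
      ring
    · have : -1 ≤ -1 / m := by rw [le_div_iff₀ hm0]; linarith
      linarith
  have h2 : m ^ p * (1 - p / m) = m ^ p - p * m ^ (p - 1) := by
    rw [Real.rpow_sub_one hm0.ne']
    ring
  have h3 : n ^ (p - 1) ≤ m ^ (p - 1) :=
    Real.rpow_le_rpow_of_nonpos hm0 hmn (by linarith)
  nlinarith

theorem SigmaH_comm (H δ : ℝ) (N : ℕ) (i j : Fin N) : SigmaH H δ N i j = SigmaH H δ N j i := by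
  unfold SigmaH
  rw [show (j : ℝ) - i + 1 = -((i : ℝ) - j - 1) by ring,
    show (j : ℝ) - i - 1 = -((i : ℝ) - j + 1) by ring,
    show (j : ℝ) - i = -((i : ℝ) - j) by ring, abs_neg, abs_neg, abs_neg]
  ring

theorem SigmaH_offDiag_nonpos {H δ : ℝ} (h0 : 0 ≤ H) (h1 : H ≤ 1 / 2) (hδ : 0 ≤ δ) {N : ℕ}
    {i j : Fin N} (hij : i ≠ j) : SigmaH H δ N i j ≤ 0 := by
  refine mul_nonpos_of_nonneg_of_nonpos (by positivity)
    (rpow_second_difference_nonpos (by linarith) (by linarith) ?_)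
  have h : ((i : ℕ) : ℤ) - ((j : ℕ) : ℤ) ≠ 0 := by
    have := Fin.val_ne_of_ne hij
    omega
  have := Int.one_le_abs h
  exact_mod_cast this

theorem le_SigmaH_row_sum {H δ : ℝ} (h0 : 0 < H) (h1 : H ≤ 1 / 2) (hδ : 0 ≤ δ) {N : ℕ}
    (i : Fin N) :
    2 * H * δ ^ (2 * H) * (N : ℝ) ^ (2 * H - 1) ≤ ∑ j, SigmaH H δ N i j := by
  have hi : (i : ℝ) + 1 ≤ N := by exact_mod_cast i.2
  have hi0 : (0 : ℝ) ≤ i := by positivity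
  have htel : ∑ j : Fin N, (|(i : ℝ) - (j : ℝ) + 1| ^ (2 * H) + |(i : ℝ) - (j : ℝ) - 1| ^ (2 * H)
      - 2 * |(i : ℝ) - (j : ℝ)| ^ (2 * H))
      = (((i : ℝ) + 1) ^ (2 * H) - ((i : ℝ) + 1 - 1) ^ (2 * H))
        + (((N : ℝ) - i) ^ (2 * H) - ((N : ℝ) - i - 1) ^ (2 * H)) := by
    rw [Fin.sum_univ_eq_sum_range (fun j : ℕ => |(i : ℝ) - (j : ℝ) + 1| ^ (2 * H)
      + |(i : ℝ) - (j : ℝ) - 1| ^ (2 * H) - 2 * |(i : ℝ) - (j : ℝ)| ^ (2 * H))]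
    have h := Finset.sum_range_sub'
      (fun j : ℕ => |(i : ℝ) - (j : ℝ) + 1| ^ (2 * H) - |(i : ℝ) - (j : ℝ)| ^ (2 * H)) N
    have e : ∀ j : ℕ, |(i : ℝ) - (j : ℝ) + 1| ^ (2 * H)
        + |(i : ℝ) - (j : ℝ) - 1| ^ (2 * H) - 2 * |(i : ℝ) - (j : ℝ)| ^ (2 * H)
        = (|(i : ℝ) - (j : ℝ) + 1| ^ (2 * H) - |(i : ℝ) - (j : ℝ)| ^ (2 * H))
          - (|(i : ℝ) - ((j + 1 : ℕ) : ℝ) + 1| ^ (2 * H)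
            - |(i : ℝ) - ((j + 1 : ℕ) : ℝ)| ^ (2 * H)) := by
      intro j
      push_cast
      rw [show (i : ℝ) - (j + 1) + 1 = i - j by ring, show (i : ℝ) - (j + 1) = i - j - 1 by ring]
      ring
    rw [Finset.sum_congr rfl fun j _ => e j, h]
    simp only [Nat.cast_zero, sub_zero]
    rw [abs_of_nonneg (by linarith : (0 : ℝ) ≤ i + 1), abs_of_nonneg hi0,
      abs_of_nonpos (by linarith : (i : ℝ) - N + 1 ≤ 0),
      abs_of_nonpos (by linarith : (i : ℝ) - N ≤ 0),
      show -((i : ℝ) - N + 1) = N - i - 1 by ring, show -((i : ℝ) - N) = N - i by ring,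
      show (i : ℝ) + 1 - 1 = i by ring]
    ring
  have hA := mul_rpow_le_rpow_sub_rpow (p := 2 * H) (m := (i : ℝ) + 1) (n := N)
    (by linarith) (by linarith) (by linarith) hi
  have hB := mul_rpow_le_rpow_sub_rpow (p := 2 * H) (m := (N : ℝ) - i) (n := N)
    (by linarith) (by linarith) (by linarith) (by linarith)
  unfold SigmaH
  rw [← Finset.mul_sum, htel]
  have hd : 0 ≤ δ ^ (2 * H) / 2 := by positivity
  refine le_trans (le_of_eq ?_) (mul_le_mul_of_nonneg_left (add_le_add hA hB) hd)
  ring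

theorem SigmaH_quadForm_lower_bound {H δ : ℝ} (h0 : 0 < H) (h1 : H ≤ 1 / 2) (hδ : 0 ≤ δ) {N : ℕ}
    (a : Fin N → ℝ) :
    2 * H * δ ^ (2 * H) * (N : ℝ) ^ (2 * H - 1) * ∑ i, a i ^ 2
      ≤ ∑ i, ∑ j, a i * a j * SigmaH H δ N i j :=
  sum_sq_le_quadForm_of_offDiag_nonpos _ (SigmaH_comm H δ N)
    (fun _ _ => SigmaH_offDiag_nonpos h0.le h1 hδ) _ (le_SigmaH_row_sum h0 h1 hδ) a

theorem dotProduct_mulVec_eq_sum {ι : Type*} [Fintype ι] (M : Matrix ι ι ℝ) (a b : ι → ℝ) :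
    a ⬝ᵥ M *ᵥ b = ∑ i, ∑ j, a i * b j * M i j := by
  simp only [dotProduct, mulVec, Finset.mul_sum]
  exact Finset.sum_congr rfl fun i _ => Finset.sum_congr rfl fun j _ => by ring

theorem SigmaH_posDef {H δ : ℝ} (h0 : 0 < H) (h1 : H ≤ 1 / 2) (hδ : 0 < δ) (N : ℕ) :
    (SigmaH H δ N).PosDef := by
  refine Matrix.PosDef.of_dotProduct_mulVec_pos ?_ fun x hx => ?_
  · ext i j
    simpa using SigmaH_comm H δ N j i
  · rw [star_trivial, dotProduct_mulVec_eq_sum]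
    refine lt_of_lt_of_le ?_ (SigmaH_quadForm_lower_bound h0 h1 hδ.le x)
    obtain ⟨i, hi⟩ := Function.ne_iff.1 hx
    have hN : 0 < N := i.pos
    have : 0 < ∑ i, x i ^ 2 :=
      Finset.sum_pos' (fun j _ => sq_nonneg _)
        ⟨i, Finset.mem_univ _, sq_pos_of_ne_zero hi⟩
    positivity

/-- If the quadratic form of `M` dominates `c` times the squared norm, then that of `M⁻¹` is
dominated by `c⁻¹` times the squared norm. -/
theorem quadForm_inv_le {ι : Type*} [Fintype ι] [DecidableEq ι] {M : Matrix ι ι ℝ}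
    (hM : IsUnit M.det) {c : ℝ} (hc : 0 < c)
    (h : ∀ a : ι → ℝ, c * ∑ i, a i ^ 2 ≤ a ⬝ᵥ M *ᵥ a) (x : ι → ℝ) :
    x ⬝ᵥ M⁻¹ *ᵥ x ≤ (∑ i, x i ^ 2) / c := by
  set y := M⁻¹ *ᵥ x with hy
  have hx : M *ᵥ y = x := by
    rw [hy, mulVec_mulVec, Matrix.mul_nonsing_inv _ hM, one_mulVec]
  have h1 := h y
  rw [hx] at h1
  have h2 : y ⬝ᵥ x = x ⬝ᵥ y := dotProduct_comm _ _
  rw [le_div_iff₀ hc]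
  have h3 : 0 ≤ ∑ i, (x i - c * y i) ^ 2 := Finset.sum_nonneg fun _ _ => sq_nonneg _
  have h4 : ∑ i, (x i - c * y i) ^ 2
      = ∑ i, x i ^ 2 - 2 * c * (x ⬝ᵥ y) + c ^ 2 * ∑ i, y i ^ 2 := by
    simp only [dotProduct, Finset.mul_sum, ← Finset.sum_sub_distrib, ← Finset.sum_add_distrib]
    exact Finset.sum_congr rfl fun i _ => by ring
  nlinarith

theorem integral_pow_four_gaussianReal (v : NNReal) :
    ∫ x, x ^ 4 ∂(gaussianReal 0 v) = 3 * (v : ℝ) ^ 2 := by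
  have h0 : ∫ x, x ^ 4 ∂(gaussianReal 0 v)
      = iteratedDeriv 4 (mgf (fun x ↦ x) (gaussianReal 0 v)) 0 := by
    rw [iteratedDeriv_mgf_zero] <;> simp
  have hd : ∀ q q' : ℝ → ℝ, (∀ t, HasDerivAt q (q' t) t) →
      deriv (fun t => q t * Real.exp (v * t ^ 2 / 2))
        = fun t => (q' t + v * t * q t) * Real.exp (v * t ^ 2 / 2) := by
    intro q q' hq
    ext t
    have h1 : HasDerivAt (fun t : ℝ => (v : ℝ) * t ^ 2 / 2) (v * t) t := by
      have := ((hasDerivAt_pow 2 t).const_mul (v : ℝ)).div_const 2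
      convert! this using 1
      simp
      ring
    have := ((hq t).mul h1.exp).deriv
    rw [show (fun t => q t * Real.exp (v * t ^ 2 / 2))
      = q * fun t => Real.exp (v * t ^ 2 / 2) from rfl, this]
    ring
  rw [h0, mgf_fun_id_gaussianReal, iteratedDeriv_succ, iteratedDeriv_succ, iteratedDeriv_succ,
    iteratedDeriv_one]
  have e0 : (fun t : ℝ => Real.exp (0 * t + v * t ^ 2 / 2))
      = fun t => (fun _ => (1 : ℝ)) t * Real.exp (v * t ^ 2 / 2) := by
    ext t
    simp
  rw [e0, hd (fun _ => 1) (fun _ => 0) fun t => hasDerivAt_const t 1,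
    hd (fun t => 0 + v * t * 1) (fun _ => v) fun t => by
      simpa using (hasDerivAt_id t).const_mul (v : ℝ),
    hd (fun t => v + v * t * (0 + v * t * 1)) (fun t => 2 * v ^ 2 * t) fun t => by
      have := ((hasDerivAt_pow 2 t).const_mul ((v : ℝ) ^ 2)).const_add (v : ℝ)
      convert! this using 1
      · ext s
        ring
      · simp
        ring,
    hd (fun t => 2 * v ^ 2 * t + v * t * (v + v * t * (0 + v * t * 1)))
      (fun t => 3 * v ^ 2 + 3 * v ^ 3 * t ^ 2) fun t => by
      have := ((hasDerivAt_id t).const_mul (3 * (v : ℝ) ^ 2)).add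
        ((hasDerivAt_pow 3 t).const_mul ((v : ℝ) ^ 3))
      convert! this using 1
      · ext s
        simp
        ring
      · simp
        ring]
  simp

theorem integral_sq_gaussianReal (v : NNReal) : ∫ x, x ^ 2 ∂(gaussianReal 0 v) = v := by
  have h := variance_fun_id_gaussianReal (μ := 0) (v := v)
  rw [variance_eq_integral measurable_id'.aemeasurable] at h
  simpa using h

section GaussianVariable

variable {Ω : Type*} [MeasurableSpace Ω] {P : Measure Ω} {U : Ω → ℝ} {v : NNReal}

theorem aemeasurable_of_map_eq_gaussianReal (hU : P.map U = gaussianReal 0 v) :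
    AEMeasurable U P :=
  aemeasurable_of_map_neZero (by rw [hU]; infer_instance)

theorem memLp_of_map_eq_gaussianReal (hU : P.map U = gaussianReal 0 v) (p : NNReal) :
    MemLp U p P := by
  have h : MemLp id p (P.map U) := by
    rw [hU]
    exact memLp_id_gaussianReal p
  exact h.comp_of_map (aemeasurable_of_map_eq_gaussianReal hU)

theorem integral_sq_of_map_eq_gaussianReal (hU : P.map U = gaussianReal 0 v) :
    ∫ ω, U ω ^ 2 ∂P = v := by
  rw [← integral_sq_gaussianReal, ← hU,
    integral_map (aemeasurable_of_map_eq_gaussianReal hU) (by fun_prop)]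

theorem integral_pow_four_of_map_eq_gaussianReal (hU : P.map U = gaussianReal 0 v) :
    ∫ ω, U ω ^ 4 ∂P = 3 * (v : ℝ) ^ 2 := by
  rw [← integral_pow_four_gaussianReal, ← hU,
    integral_map (aemeasurable_of_map_eq_gaussianReal hU) (by fun_prop)]

theorem integrable_sq_of_map_eq_gaussianReal (hU : P.map U = gaussianReal 0 v) :
    Integrable (fun ω => U ω ^ 2) P :=
  (memLp_of_map_eq_gaussianReal hU 2).integrable_sq

theorem integrable_pow_four_of_map_eq_gaussianReal (hU : P.map U = gaussianReal 0 v) :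
    Integrable (fun ω => U ω ^ 4) P := by
  have h := (memLp_of_map_eq_gaussianReal hU 4).integrable_norm_pow (p := 4) (by norm_num)
  refine h.congr (ae_of_all _ fun ω => ?_)
  simp [Real.norm_eq_abs, (by decide : Even 4).pow_abs]

end GaussianVariable

section StandardGaussianVector

variable {Ω ι : Type*} [MeasurableSpace Ω] {P : Measure Ω} [Fintype ι] [DecidableEq ι]
  {W : ι → Ω → ℝ}

theorem integral_sq_mul_sq_of_standardGaussian
    (hW : ∀ c : ι → ℝ, P.map (fun ω => ∑ i, c i * W i ω)
      = gaussianReal 0 (∑ i, c i ^ 2).toNNReal) (i j : ι) :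
    Integrable (fun ω => W i ω ^ 2 * W j ω ^ 2) P ∧
      ∫ ω, W i ω ^ 2 * W j ω ^ 2 ∂P = if i = j then 3 else 1 := by
  have hsingle : ∀ i, P.map (W i) = gaussianReal 0 1 := by
    intro i
    have := hW (Pi.single i 1)
    simpa [Pi.single_apply] using this
  by_cases hij : i = j
  · subst hij
    have e : (fun ω => W i ω ^ 2 * W i ω ^ 2) = fun ω => W i ω ^ 4 := by
      ext ω
      ring
    rw [e, integral_pow_four_of_map_eq_gaussianReal (hsingle i)]
    exact ⟨integrable_pow_four_of_map_eq_gaussianReal (hsingle i), by simp⟩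
  · have hpair : ∀ s : ℝ, s ^ 2 = 1 →
        P.map (fun ω => W i ω + s * W j ω) = gaussianReal 0 2 := by
      intro s hs
      have := hW (Pi.single i 1 + Pi.single j s)
      have e : ∑ k, (Pi.single i (1 : ℝ) + Pi.single j s : ι → ℝ) k ^ 2 = 2 := by
        have : ∀ k, (Pi.single i (1 : ℝ) + Pi.single j s : ι → ℝ) k ^ 2
            = (if k = i then 1 else 0) + (if k = j then 1 else 0) := by
          intro k
          by_cases h1 : k = i
          · subst h1
            simp [hij]
          · by_cases h2 : k = j
            · subst h2
              simp [h1, hs]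
            · simp [h1, h2]
        simp only [this, Finset.sum_add_distrib]
        simp
        norm_num
      rw [e] at this
      simpa [Pi.single_apply, add_mul, Finset.sum_add_distrib] using this
    have hp := hpair 1 (by norm_num)
    have hm := hpair (-1) (by norm_num)
    have Ip := integrable_pow_four_of_map_eq_gaussianReal hp
    have Im := integrable_pow_four_of_map_eq_gaussianReal hm
    have Ii := integrable_pow_four_of_map_eq_gaussianReal (hsingle i)
    have Ij := integrable_pow_four_of_map_eq_gaussianReal (hsingle j)
    have e : (fun ω => W i ω ^ 2 * W j ω ^ 2) = fun ω => 1 / 12 * ((W i ω + 1 * W j ω) ^ 4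
        + (W i ω + -1 * W j ω) ^ 4) - 1 / 6 * (W i ω ^ 4 + W j ω ^ 4) := by
      ext ω
      ring
    rw [e]
    have I1 : Integrable (fun ω => 1 / 12 * ((W i ω + 1 * W j ω) ^ 4
        + (W i ω + -1 * W j ω) ^ 4)) P := (Ip.add Im).const_mul _
    have I2 : Integrable (fun ω => 1 / 6 * (W i ω ^ 4 + W j ω ^ 4)) P := (Ii.add Ij).const_mul _
    refine ⟨I1.sub I2, ?_⟩
    rw [integral_sub I1 I2, integral_const_mul,
      integral_const_mul, integral_add Ip Im, integral_add Ii Ij,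
      integral_pow_four_of_map_eq_gaussianReal hp, integral_pow_four_of_map_eq_gaussianReal hm,
      integral_pow_four_of_map_eq_gaussianReal (hsingle i),
      integral_pow_four_of_map_eq_gaussianReal (hsingle j), if_neg hij]
    norm_num

theorem chiSq_moments_of_standardGaussian
    (hW : ∀ c : ι → ℝ, P.map (fun ω => ∑ i, c i * W i ω)
      = gaussianReal 0 (∑ i, c i ^ 2).toNNReal) :
    (Integrable (fun ω => ∑ i, W i ω ^ 2) P ∧ ∫ ω, ∑ i, W i ω ^ 2 ∂P = Fintype.card ι) ∧
    (Integrable (fun ω => (∑ i, W i ω ^ 2) ^ 2) P ∧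
      ∫ ω, (∑ i, W i ω ^ 2) ^ 2 ∂P = (Fintype.card ι : ℝ) ^ 2 + 2 * Fintype.card ι) := by
  have hsingle : ∀ i, P.map (W i) = gaussianReal 0 1 := by
    intro i
    have := hW (Pi.single i 1)
    simpa [Pi.single_apply] using this
  have h2 := fun i => integrable_sq_of_map_eq_gaussianReal (hsingle i)
  have h4 := integral_sq_mul_sq_of_standardGaussian hW
  have e : (fun ω => (∑ i, W i ω ^ 2) ^ 2) = fun ω => ∑ i, ∑ j, W i ω ^ 2 * W j ω ^ 2 := by
    ext ω
    rw [sq, Finset.sum_mul_sum]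
  refine ⟨⟨integrable_finsetSum _ fun i _ => h2 i, ?_⟩, ?_, ?_⟩
  · rw [integral_finsetSum _ fun i _ => h2 i]
    simp [integral_sq_of_map_eq_gaussianReal (hsingle _)]
  · rw [e]
    exact integrable_finsetSum _ fun i _ => integrable_finsetSum _ fun j _ => (h4 i j).1
  · rw [e, integral_finsetSum _ fun i _ => integrable_finsetSum _ fun j _ => (h4 i j).1]
    have : ∀ i, ∫ ω, ∑ j, W i ω ^ 2 * W j ω ^ 2 ∂P = Fintype.card ι + 2 := by
      intro i
      rw [integral_finsetSum _ fun j _ => (h4 i j).1]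
      have e2 : ∀ j, ∫ ω, W i ω ^ 2 * W j ω ^ 2 ∂P = 1 + if i = j then 2 else 0 := by
        intro j
        rw [(h4 i j).2]
        split_ifs <;> norm_num
      simp [e2, Finset.sum_add_distrib]
    simp only [this, Finset.sum_const, Finset.card_univ, nsmul_eq_mul]
    ring

end StandardGaussianVector

open scoped MatrixOrder in
theorem exists_whitening {ι : Type*} [Fintype ι] [DecidableEq ι] {M : Matrix ι ι ℝ}
    (hM : M.PosDef) : ∃ L : Matrix ι ι ℝ, Lᵀ * L = M⁻¹ ∧ L * M * Lᵀ = 1 := by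
  obtain ⟨L, hL⟩ := CStarAlgebra.nonneg_iff_eq_star_mul_self.mp hM.inv.posSemidef.nonneg
  rw [star_eq_conjTranspose, conjTranspose_eq_transpose_of_trivial] at hL
  refine ⟨L, hL.symm, ?_⟩
  have h1 : (M * Lᵀ) * L = 1 := by
    rw [Matrix.mul_assoc, ← hL,
      Matrix.mul_nonsing_inv _ ((Matrix.isUnit_iff_isUnit_det _).1 hM.isUnit)]
  rw [Matrix.mul_assoc]
  exact mul_eq_one_comm.1 h1

theorem quadForm_inv_moments_of_gaussian {Ω ι : Type*} [MeasurableSpace Ω] {P : Measure Ω}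
    [Fintype ι] [DecidableEq ι] {Z : ι → Ω → ℝ} {M : Matrix ι ι ℝ} (hM : M.PosDef)
    (hZ : ∀ a : ι → ℝ, P.map (fun ω => ∑ i, a i * Z i ω)
      = gaussianReal 0 (∑ i, ∑ j, a i * a j * M i j).toNNReal) :
    (Integrable (fun ω => (fun i => Z i ω) ⬝ᵥ M⁻¹ *ᵥ fun i => Z i ω) P ∧
      ∫ ω, (fun i => Z i ω) ⬝ᵥ M⁻¹ *ᵥ (fun i => Z i ω) ∂P = Fintype.card ι) ∧
    (Integrable (fun ω => ((fun i => Z i ω) ⬝ᵥ M⁻¹ *ᵥ fun i => Z i ω) ^ 2) P ∧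
      ∫ ω, ((fun i => Z i ω) ⬝ᵥ M⁻¹ *ᵥ fun i => Z i ω) ^ 2 ∂P
        = (Fintype.card ι : ℝ) ^ 2 + 2 * Fintype.card ι) := by
  obtain ⟨L, hL1, hL2⟩ := exists_whitening hM
  have hq : ∀ z : ι → ℝ, z ⬝ᵥ M⁻¹ *ᵥ z = ∑ i, (L *ᵥ z) i ^ 2 := by
    intro z
    rw [← hL1, ← mulVec_mulVec, dotProduct_mulVec, vecMul_transpose]
    exact Finset.sum_congr rfl fun i _ => (sq _).symm
  simp only [hq]
  refine chiSq_moments_of_standardGaussian (W := fun i ω => (L *ᵥ fun i => Z i ω) i) fun c => ?_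
  have e1 : ∀ ω, ∑ i, c i * (L *ᵥ fun i => Z i ω) i = ∑ i, (Lᵀ *ᵥ c) i * Z i ω := by
    intro ω
    have : c ⬝ᵥ L *ᵥ (fun i => Z i ω) = (Lᵀ *ᵥ c) ⬝ᵥ fun i => Z i ω := by
      rw [dotProduct_mulVec, mulVec_transpose]
    exact this
  have e2 : ∑ i, ∑ j, (Lᵀ *ᵥ c) i * (Lᵀ *ᵥ c) j * M i j = ∑ i, c i ^ 2 := by
    rw [← dotProduct_mulVec_eq_sum, mulVec_mulVec, mulVec_transpose, ← dotProduct_mulVec,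
      mulVec_mulVec, ← Matrix.mul_assoc, hL2, one_mulVec]
    exact Finset.sum_congr rfl fun i _ => (sq _).symm
  simp only [e1]
  rw [hZ, e2]

section FractionalBrownianMotion

variable {Ω : Type*} [MeasureSpace Ω] {H : ℝ} {B : ℝ → Ω → ℝ}

theorem IsTwoSidedFBM.map_sum_eq (hB : IsTwoSidedFBM H B) {ι : Type*} [Fintype ι]
    (t a : ι → ℝ) :
    Measure.map (fun ω => ∑ i, a i * B (t i) ω) (ℙ : Measure Ω)
      = gaussianReal 0 (∑ i, ∑ j, a i * a j * fbmCov H (t i) (t j)).toNNReal := by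
  let e := Fintype.equivFin ι
  have h := hB.gaussian (Fintype.card ι) (t ∘ e.symm) (a ∘ e.symm)
  have e1 : ∀ ω, ∑ i, (a ∘ e.symm) i * B ((t ∘ e.symm) i) ω = ∑ i, a i * B (t i) ω :=
    fun ω => e.symm.sum_comp fun i => a i * B (t i) ω
  have e2 : ∑ i, ∑ j, (a ∘ e.symm) i * (a ∘ e.symm) j
      * fbmCov H ((t ∘ e.symm) i) ((t ∘ e.symm) j)
      = ∑ i, ∑ j, a i * a j * fbmCov H (t i) (t j) := by
    rw [← e.symm.sum_comp fun i => ∑ j, a i * a j * fbmCov H (t i) (t j)]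
    exact Finset.sum_congr rfl fun i _ =>
      e.symm.sum_comp fun j => a (e.symm i) * a j * fbmCov H (t (e.symm i)) (t j)
  simp only [e1, e2] at h
  exact h

theorem IsTwoSidedFBM.map_sum_increments_eq (hB : IsTwoSidedFBM H B) {ι : Type*} [Fintype ι]
    (s t a : ι → ℝ) :
    Measure.map (fun ω => ∑ i, a i * (B (t i) ω - B (s i) ω)) (ℙ : Measure Ω)
      = gaussianReal 0 (∑ i, ∑ j, a i * a j * ((|t i - s j| ^ (2 * H) + |s i - t j| ^ (2 * H)
          - |t i - t j| ^ (2 * H) - |s i - s j| ^ (2 * H)) / 2)).toNNReal := by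
  have h := hB.map_sum_eq (Sum.elim t s) (Sum.elim a fun i => -a i)
  simp only [Fintype.sum_sum_type, Sum.elim_inl, Sum.elim_inr] at h
  convert! h using 3
  · rw [← Finset.sum_add_distrib]
    exact Finset.sum_congr rfl fun i _ => by ring
  · rw [← Finset.sum_add_distrib]
    refine Finset.sum_congr rfl fun i _ => ?_
    simp only [← Finset.sum_add_distrib]
    refine Finset.sum_congr rfl fun j _ => ?_
    unfold fbmCov
    ring

theorem IsTwoSidedFBM.map_sum_grid_increments_eq (hB : IsTwoSidedFBM H B) {δ : ℝ} (hδ : 0 ≤ δ)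
    {N : ℕ} (a : Fin N → ℝ) :
    Measure.map (fun ω => ∑ i : Fin N, a i * (B (((i : ℕ) + 1 : ℝ) * δ) ω - B ((i : ℕ) * δ) ω))
      (ℙ : Measure Ω) = gaussianReal 0 (∑ i, ∑ j, a i * a j * SigmaH H δ N i j).toNNReal := by
  rw [hB.map_sum_increments_eq (fun i : Fin N => (i : ℝ) * δ) (fun i => ((i : ℝ) + 1) * δ)]
  congr 2
  refine Finset.sum_congr rfl fun i _ => Finset.sum_congr rfl fun j _ => ?_
  unfold SigmaH
  rw [← sub_mul, ← sub_mul, ← sub_mul, ← sub_mul, abs_mul, abs_mul, abs_mul, abs_mul,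
    abs_of_nonneg hδ, Real.mul_rpow (abs_nonneg _) hδ, Real.mul_rpow (abs_nonneg _) hδ,
    Real.mul_rpow (abs_nonneg _) hδ, Real.mul_rpow (abs_nonneg _) hδ,
    show (i : ℝ) + 1 - j = i - j + 1 by ring, show (i : ℝ) - (j + 1) = i - j - 1 by ring,
    show (i : ℝ) + 1 - (j + 1) = i - j by ring]
  ring

theorem IsTwoSidedFBM.map_sub_eq (hB : IsTwoSidedFBM H B) (hH : 0 < H) (s t : ℝ) :
    Measure.map (fun ω => B t ω - B s ω) (ℙ : Measure Ω)
      = gaussianReal 0 (|t - s| ^ (2 * H)).toNNReal := by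
  have h := hB.map_sum_increments_eq (fun _ : Unit => s) (fun _ => t) (fun _ => 1)
  simp only [Finset.univ_unique, Finset.sum_const, Finset.card_singleton, one_smul, one_mul,
    sub_self, abs_zero] at h
  rw [h, abs_sub_comm s t, Real.zero_rpow (by positivity)]
  congr 2
  ring

theorem IsTwoSidedFBM.integrable_sub_pow_four (hB : IsTwoSidedFBM H B) (hH : 0 < H) (s t : ℝ) :
    Integrable (fun ω => (B t ω - B s ω) ^ 4) (ℙ : Measure Ω) :=
  integrable_pow_four_of_map_eq_gaussianReal (hB.map_sub_eq hH s t)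

theorem IsTwoSidedFBM.integral_sub_pow_four (hB : IsTwoSidedFBM H B) (hH : 0 < H) (s t : ℝ) :
    ∫ ω, (B t ω - B s ω) ^ 4 = 3 * |t - s| ^ (4 * H) := by
  rw [integral_pow_four_of_map_eq_gaussianReal (hB.map_sub_eq hH s t),
    Real.coe_toNNReal _ (by positivity), ← Real.rpow_natCast, ← Real.rpow_mul (abs_nonneg _)]
  congr 2
  push_cast
  ring

end FractionalBrownianMotion

section ExponentialKernel

theorem integral_Iic_comp_sub (t : ℝ) (f : ℝ → ℝ) :
    ∫ s in Set.Iic t, f (t - s) = ∫ u in Set.Ioi 0, f u := by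
  rw [← integral_Ici_eq_integral_Ioi, ← integral_indicator measurableSet_Iic,
    ← integral_indicator measurableSet_Ici, ← integral_sub_left_eq_self _ volume t]
  congr 1
  ext s
  simp [Set.indicator]

theorem integrableOn_Iic_comp_sub {t : ℝ} {f : ℝ → ℝ} (hf : IntegrableOn f (Set.Ioi 0)) :
    IntegrableOn (fun s => f (t - s)) (Set.Iic t) := by
  rw [← integrableOn_Ici_iff_integrableOn_Ioi, ← integrable_indicator_iff measurableSet_Ici] at hf
  rw [← integrable_indicator_iff measurableSet_Iic]
  refine (hf.comp_sub_left t).congr (ae_of_all _ fun s => ?_)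
  simp [Set.indicator]

theorem integral_expKernel_mul_rpow {ε p : ℝ} (hε : 0 < ε) (hp : 0 ≤ p) (t : ℝ) :
    IntegrableOn (fun s => 1 / ε * Real.exp (-(t - s) / ε) * |t - s| ^ p) (Set.Iic t) ∧
    ∫ s in Set.Iic t, 1 / ε * Real.exp (-(t - s) / ε) * |t - s| ^ p
      = ε ^ p * Real.Gamma (p + 1) := by
  have hε' : 0 < 1 / ε := by positivity
  have e : ∀ u ∈ Set.Ioi (0 : ℝ), 1 / ε * Real.exp (-u / ε) * |u| ^ p
      = 1 / ε * (u ^ (p + 1 - 1) * Real.exp (-(1 / ε * u))) := by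
    intro u hu
    rw [abs_of_pos hu, add_sub_cancel_right, show -u / ε = -(1 / ε * u) by ring]
    ring
  have hval : ∫ u in Set.Ioi (0 : ℝ), 1 / ε * Real.exp (-u / ε) * |u| ^ p
      = ε ^ p * Real.Gamma (p + 1) := by
    rw [setIntegral_congr_fun measurableSet_Ioi e, integral_const_mul,
      Real.integral_rpow_mul_exp_neg_mul_Ioi (by linarith) hε', one_div_one_div,
      Real.rpow_add_one hε.ne']
    field_simp
  have hpos : 0 < ε ^ p * Real.Gamma (p + 1) :=
    mul_pos (Real.rpow_pos_of_pos hε _) (Real.Gamma_pos_of_pos (by linarith))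
  refine ⟨integrableOn_Iic_comp_sub (f := fun u => 1 / ε * Real.exp (-u / ε) * |u| ^ p) ?_, ?_⟩
  · by_contra hn
    rw [integral_undef hn] at hval
    exact hpos.ne hval
  · rw [integral_Iic_comp_sub t fun u => 1 / ε * Real.exp (-u / ε) * |u| ^ p, hval]

theorem pow_four_integral_le {α : Type*} [MeasurableSpace α] {μ : Measure α} {w x : α → ℝ}
    (hw : ∀ s, 0 ≤ w s) (hwi : Integrable w μ) (hw1 : ∫ s, w s ∂μ = 1)
    (hx : Integrable (fun s => w s * x s) μ) (hx4 : Integrable (fun s => w s * x s ^ 4) μ) :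
    (∫ s, w s * x s ∂μ) ^ 4 ≤ ∫ s, w s * x s ^ 4 ∂μ := by
  set m := ∫ s, w s * x s ∂μ with hm
  have h1 : ∫ s, (4 * m ^ 3 * (w s * x s) - 3 * m ^ 4 * w s) ∂μ ≤ ∫ s, w s * x s ^ 4 ∂μ := by
    refine integral_mono ((hx.const_mul _).sub (hwi.const_mul _)) hx4 fun s => ?_
    have h2 : 0 ≤ x s ^ 4 - 4 * m ^ 3 * x s + 3 * m ^ 4 := by
      nlinarith [sq_nonneg (x s - m), sq_nonneg ((x s - m) * (x s + m)),
        sq_nonneg ((x s - m) * m)]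
    have h3 := mul_nonneg (hw s) h2
    simp only
    linarith
  rw [integral_sub (hx.const_mul _) (hwi.const_mul _), integral_const_mul, integral_const_mul,
    hw1, ← hm] at h1
  linarith

variable {ε : ℝ} {b : ℝ → ℝ}

theorem integrableOn_expKernel_mul (hb : Continuous b) {t : ℝ}
    (hi : IntegrableOn (fun s => Real.exp (-(t - s) / ε) * |b s|) (Set.Iic t)) :
    IntegrableOn (fun s => Real.exp (-(t - s) / ε) * b s) (Set.Iic t) := by
  refine Integrable.mono' hi (by fun_prop) (ae_of_all _ fun s => ?_)
  rw [norm_mul, Real.norm_eq_abs, Real.norm_eq_abs, abs_of_pos (Real.exp_pos _)]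

theorem hasDerivAt_expKernel_integral (hb : Continuous b)
    (hi : ∀ t, IntegrableOn (fun s => Real.exp (-(t - s) / ε) * |b s|) (Set.Iic t)) (t : ℝ) :
    HasDerivAt (fun t => ∫ s in Set.Iic t, Real.exp (-(t - s) / ε) * b s)
      (b t - 1 / ε * ∫ s in Set.Iic t, Real.exp (-(t - s) / ε) * b s) t := by
  have hfac : ∀ t s : ℝ, Real.exp (-(t - s) / ε) * b s
      = Real.exp (-t / ε) * (Real.exp (s / ε) * b s) := by
    intro t s
    rw [← mul_assoc, ← Real.exp_add]
    congr 2
    ring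
  have hk : Continuous fun s => Real.exp (s / ε) * b s := by fun_prop
  have hki : ∀ t, IntegrableOn (fun s => Real.exp (s / ε) * b s) (Set.Iic t) := by
    intro t
    have h := (integrableOn_expKernel_mul hb (hi t)).const_mul (Real.exp (t / ε))
    refine h.congr (ae_of_all _ fun s => ?_)
    simp only [hfac]
    rw [← mul_assoc, ← Real.exp_add, show t / ε + -t / ε = 0 by ring, Real.exp_zero, one_mul]
  have hG : ∀ t, ∫ s in Set.Iic t, Real.exp (-(t - s) / ε) * b s = Real.exp (-t / ε)
      * ((∫ s in Set.Iic 0, Real.exp (s / ε) * b s)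
        + ∫ s in (0 : ℝ)..t, Real.exp (s / ε) * b s) := by
    intro t
    rw [← intervalIntegral.integral_Iic_sub_Iic (hki 0) (hki t), add_sub_cancel,
      ← integral_const_mul]
    simp only [hfac]
  simp only [hG]
  have h1 : HasDerivAt (fun t : ℝ => Real.exp (-t / ε)) (Real.exp (-t / ε) * (-1 / ε)) t :=
    ((hasDerivAt_id t).neg.div_const ε).exp
  have h2 : HasDerivAt (fun t => (∫ s in Set.Iic 0, Real.exp (s / ε) * b s)
      + ∫ s in (0 : ℝ)..t, Real.exp (s / ε) * b s) (Real.exp (t / ε) * b t) t :=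
    (hk.integral_hasStrictDerivAt 0 t).hasDerivAt.const_add _
  have h3 : Real.exp (-t / ε) * (Real.exp (t / ε) * b t) = b t := by
    rw [← mul_assoc, ← Real.exp_add, show -t / ε + t / ε = 0 by ring, Real.exp_zero, one_mul]
  convert! h1.mul h2 using 1
  rw [h3]
  ring

theorem integral_sub_expKernel_integral (hb : Continuous b)
    (hi : ∀ t, IntegrableOn (fun s => Real.exp (-(t - s) / ε) * |b s|) (Set.Iic t)) (t : ℝ) :
    ∫ r in (0 : ℝ)..t, (b r - 1 / ε * ∫ s in Set.Iic r, Real.exp (-(r - s) / ε) * b s)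
      = (∫ s in Set.Iic t, Real.exp (-(t - s) / ε) * b s)
        - ∫ s in Set.Iic 0, Real.exp (-(0 - s) / ε) * b s := by
  have hd := hasDerivAt_expKernel_integral hb hi
  have hc : Continuous fun t => ∫ s in Set.Iic t, Real.exp (-(t - s) / ε) * b s :=
    continuous_iff_continuousAt.2 fun t => (hd t).continuousAt
  exact intervalIntegral.integral_eq_sub_of_hasDerivAt (fun r _ => hd r)
    ((hb.sub (hc.const_mul _)).intervalIntegrable _ _)

theorem sub_expKernel_integral_pow_four_le (hε : 0 < ε) (hb : Continuous b) {t : ℝ}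
    (hi : IntegrableOn (fun s => Real.exp (-(t - s) / ε) * |b s|) (Set.Iic t))
    (h4 : IntegrableOn (fun s => 1 / ε * Real.exp (-(t - s) / ε) * (b t - b s) ^ 4)
      (Set.Iic t)) :
    (b t - 1 / ε * ∫ s in Set.Iic t, Real.exp (-(t - s) / ε) * b s) ^ 4
      ≤ ∫ s in Set.Iic t, 1 / ε * Real.exp (-(t - s) / ε) * (b t - b s) ^ 4 := by
  obtain ⟨hwi, hw1⟩ := integral_expKernel_mul_rpow hε le_rfl t
  simp only [Real.rpow_zero, mul_one, zero_add, Real.Gamma_one] at hwi hw1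
  have hbi := (integrableOn_expKernel_mul hb hi).const_mul (1 / ε)
  have hx : ∀ s, 1 / ε * Real.exp (-(t - s) / ε) * (b t - b s)
      = b t * (1 / ε * Real.exp (-(t - s) / ε)) - 1 / ε * (Real.exp (-(t - s) / ε) * b s) :=
    fun s => by ring
  have hxi : IntegrableOn (fun s => 1 / ε * Real.exp (-(t - s) / ε) * (b t - b s))
      (Set.Iic t) := by
    simp only [hx]
    exact (hwi.const_mul _).sub hbi
  have h := pow_four_integral_le (fun s => by positivity) hwi hw1 hxi h4
  convert! h using 2
  simp only [hx]
  rw [integral_sub (hwi.const_mul _) hbi, integral_const_mul (b t), hw1, mul_one,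
    integral_const_mul]

end ExponentialKernel

section Estimator

variable {Ω : Type*} [MeasureSpace Ω] {H : ℝ} {B : ℝ → Ω → ℝ}

theorem IsTwoSidedFBM.aestronglyMeasurable_uncurry [IsProbabilityMeasure (ℙ : Measure Ω)]
    (hB : IsTwoSidedFBM H B) (ν : Measure ℝ) [SFinite ν] :
    AEStronglyMeasurable (fun p : Ω × ℝ => B p.2 p.1) ((ℙ : Measure Ω).prod ν) := by
  classical
  obtain ⟨A, hA, hAm, hAc⟩ := hB.cont.exists_measurable_mem
  have hm : Measurable (Function.uncurry fun (s : ℝ) (ω : Ω) => if ω ∈ A then B s ω else 0) := by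
    refine measurable_uncurry_of_continuous_of_measurable (fun ω => ?_)
      fun s => Measurable.ite hAm (hB.meas s) measurable_const
    by_cases h : ω ∈ A
    · simpa [h] using hAc ω h
    · simpa [h] using continuous_const
  refine ⟨_, (hm.comp measurable_swap).stronglyMeasurable, ?_⟩
  have hae : ∀ᵐ p ∂((ℙ : Measure Ω).prod ν), p.1 ∈ A :=
    Measure.quasiMeasurePreserving_fst.ae hA
  filter_upwards [hae] with p hp
  simp [Function.uncurry, hp]

/-- Fourth moment of the increments of fractional Brownian motion averaged against an exponential
kernel. -/
theorem IsTwoSidedFBM.expKernel_fourth_moment [IsProbabilityMeasure (ℙ : Measure Ω)]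
    (hB : IsTwoSidedFBM H B) (hH : 0 < H) {ε : ℝ} (hε : 0 < ε) (t : ℝ) :
    (∀ᵐ ω : Ω, IntegrableOn
      (fun s => 1 / ε * Real.exp (-(t - s) / ε) * (B t ω - B s ω) ^ 4) (Set.Iic t)) ∧
    Integrable (fun ω =>
      ∫ s in Set.Iic t, 1 / ε * Real.exp (-(t - s) / ε) * (B t ω - B s ω) ^ 4)
      (ℙ : Measure Ω) ∧
    ∫ ω, ∫ s in Set.Iic t, 1 / ε * Real.exp (-(t - s) / ε) * (B t ω - B s ω) ^ 4
      = 3 * (ε ^ (4 * H) * Real.Gamma (4 * H + 1)) := by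
  set ν : Measure ℝ := volume.restrict (Set.Iic t)
  obtain ⟨hki, hkv⟩ := integral_expKernel_mul_rpow hε (by positivity : 0 ≤ 4 * H) t
  have hmeas : AEStronglyMeasurable
      (fun p : Ω × ℝ => 1 / ε * Real.exp (-(t - p.2) / ε) * (B t p.1 - B p.2 p.1) ^ 4)
      ((ℙ : Measure Ω).prod ν) := by
    have h1 : AEStronglyMeasurable (fun p : Ω × ℝ => B t p.1) ((ℙ : Measure Ω).prod ν) :=
      ((hB.meas t).comp measurable_fst).aestronglyMeasurable
    have h2 : Measurable fun p : Ω × ℝ => 1 / ε * Real.exp (-(t - p.2) / ε) := by fun_prop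
    exact h2.aestronglyMeasurable.mul ((h1.sub (hB.aestronglyMeasurable_uncurry ν)).pow 4)
  have hsec : ∀ s, ∫ ω, 1 / ε * Real.exp (-(t - s) / ε) * (B t ω - B s ω) ^ 4
      = 3 * (1 / ε * Real.exp (-(t - s) / ε) * |t - s| ^ (4 * H)) := by
    intro s
    rw [integral_const_mul, hB.integral_sub_pow_four hH]
    ring
  have hprod : Integrable
      (fun p : Ω × ℝ => 1 / ε * Real.exp (-(t - p.2) / ε) * (B t p.1 - B p.2 p.1) ^ 4)
      ((ℙ : Measure Ω).prod ν) := by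
    refine (integrable_prod_iff' hmeas).2
      ⟨ae_of_all _ fun s => (hB.integrable_sub_pow_four hH s t).const_mul
        (1 / ε * Real.exp (-(t - s) / ε)), ?_⟩
    have hn : ∀ s ω, ‖1 / ε * Real.exp (-(t - s) / ε) * (B t ω - B s ω) ^ 4‖
        = 1 / ε * Real.exp (-(t - s) / ε) * (B t ω - B s ω) ^ 4 := fun s ω =>
      Real.norm_of_nonneg (mul_nonneg (by positivity) (Even.pow_nonneg (by decide) _))
    simp only [hn, hsec]
    exact hki.const_mul 3
  refine ⟨hprod.prod_right_ae, hprod.integral_prod_left, ?_⟩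
  rw [integral_integral_swap
    (f := fun ω s => 1 / ε * Real.exp (-(t - s) / ε) * (B t ω - B s ω) ^ 4) hprod]
  simp only [hsec]
  rw [integral_const_mul, hkv]

theorem slowX_sub_slowX {σ ε : ℝ} (hε : 0 < ε) {ω : Ω} (hc : Continuous fun t => B t ω)
    (hi : ∀ t, IntegrableOn (fun s => Real.exp (-(t - s) / ε) * |B s ω|) (Set.Iic t))
    (s t : ℝ) :
    slowX H σ ε B t ω - slowX H σ ε B s ω = σ * ((B t ω - B s ω)
      - ((B t ω - 1 / ε * ∫ r in Set.Iic t, Real.exp (-(t - r) / ε) * B r ω)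
        - (B s ω - 1 / ε * ∫ r in Set.Iic s, Real.exp (-(s - r) / ε) * B r ω))) := by
  simp only [slowX, fracOU, intervalIntegral.integral_const_mul,
    integral_sub_expKernel_integral hc hi]
  rw [Real.rpow_sub_one hε.ne']
  have : ε ^ H ≠ 0 := (Real.rpow_pos_of_pos hε H).ne'
  field_simp
  ring

theorem sq_quadForm_inv_sub_le {ι : Type*} [Fintype ι] [DecidableEq ι] {M : Matrix ι ι ℝ}
    (hM : M.PosDef) (z d : ι → ℝ) (σ : ℝ) {n θ : ℝ} (hθ : 0 < θ) :
    (1 / n * ((fun i => σ * (z i - d i)) ⬝ᵥ M⁻¹ *ᵥ fun i => σ * (z i - d i)) - σ ^ 2) ^ 2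
      ≤ 3 * σ ^ 4 * ((1 / n * (z ⬝ᵥ M⁻¹ *ᵥ z) - 1) ^ 2
        + 2 * θ * (1 / n * (z ⬝ᵥ M⁻¹ *ᵥ z)) ^ 2
        + (1 + 2 / θ) * (1 / n * (d ⬝ᵥ M⁻¹ *ᵥ d)) ^ 2) := by
  obtain ⟨L, hL, -⟩ := exists_whitening hM
  have hq : ∀ x : ι → ℝ, x ⬝ᵥ M⁻¹ *ᵥ x = ∑ i, (L *ᵥ x) i ^ 2 := by
    intro x
    rw [← hL, ← mulVec_mulVec, dotProduct_mulVec, vecMul_transpose]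
    exact Finset.sum_congr rfl fun i _ => (sq _).symm
  have hexp : (fun i => σ * (z i - d i)) ⬝ᵥ M⁻¹ *ᵥ (fun i => σ * (z i - d i))
      = σ ^ 2 * (z ⬝ᵥ M⁻¹ *ᵥ z + d ⬝ᵥ M⁻¹ *ᵥ d - 2 * ∑ i, (L *ᵥ z) i * (L *ᵥ d) i) := by
    have hv : (fun i => σ * (z i - d i)) = σ • (z - d) := by
      ext i
      simp
    rw [hv, hq, hq, hq, mulVec_smul, mulVec_sub]
    simp only [Finset.mul_sum, ← Finset.sum_add_distrib, ← Finset.sum_sub_distrib]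
    refine Finset.sum_congr rfl fun i _ => ?_
    simp only [Pi.smul_apply, Pi.sub_apply, smul_eq_mul]
    ring
  have hcs : (∑ i, (L *ᵥ z) i * (L *ᵥ d) i) ^ 2 ≤ (z ⬝ᵥ M⁻¹ *ᵥ z) * (d ⬝ᵥ M⁻¹ *ᵥ d) := by
    rw [hq, hq]
    exact Finset.sum_mul_sq_le_sq_mul_sq _ _ _
  rw [hexp]
  generalize z ⬝ᵥ M⁻¹ *ᵥ z = Q at *
  generalize d ⬝ᵥ M⁻¹ *ᵥ d = R at *
  generalize ∑ i, (L *ᵥ z) i * (L *ᵥ d) i = c at *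
  have hcs' : (1 / n * c) ^ 2 ≤ (1 / n * Q) * (1 / n * R) := by
    have := mul_le_mul_of_nonneg_left hcs (sq_nonneg (1 / n))
    linarith
  rw [show 1 / n * (σ ^ 2 * (Q + R - 2 * c)) - σ ^ 2
    = σ ^ 2 * ((1 / n * Q - 1) + 1 / n * R - 2 * (1 / n * c)) by ring]
  generalize 1 / n * Q = Q at *
  generalize 1 / n * R = R at *
  generalize 1 / n * c = c at *
  have hyoung : 2 * (Q * R) ≤ θ * Q ^ 2 + 1 / θ * R ^ 2 := by
    have : 0 ≤ 1 / θ * (θ * Q - R) ^ 2 := by positivity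
    have e : 1 / θ * (θ * Q - R) ^ 2 = θ * Q ^ 2 + 1 / θ * R ^ 2 - 2 * (Q * R) := by
      field_simp
      ring
    linarith
  have h3 : ((Q - 1) + R - 2 * c) ^ 2 ≤ 3 * ((Q - 1) ^ 2 + R ^ 2 + 4 * c ^ 2) := by
    nlinarith [sq_nonneg (Q - 1 - R), sq_nonneg (Q - 1 + 2 * c), sq_nonneg (R + 2 * c)]
  have h4 : ((Q - 1) + R - 2 * c) ^ 2
      ≤ 3 * ((Q - 1) ^ 2 + 2 * θ * Q ^ 2 + (1 + 2 / θ) * R ^ 2) := by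
    refine h3.trans ?_
    have : 2 / θ * R ^ 2 = 2 * (1 / θ * R ^ 2) := by ring
    rw [add_mul, one_mul, this]
    linarith
  have := mul_le_mul_of_nonneg_left h4 (by positivity : 0 ≤ σ ^ 4)
  linarith

theorem sq_quadForm_inv_increments_le {H δ : ℝ} (h0 : 0 < H) (h1 : H ≤ 1 / 2) (hδ : 0 < δ)
    {N : ℕ} (hN : 0 < N) (u v U V : Fin N → ℝ) (hu : ∀ i, u i ^ 4 ≤ U i)
    (hv : ∀ i, v i ^ 4 ≤ V i) :
    ((fun i => u i - v i) ⬝ᵥ (SigmaH H δ N)⁻¹ *ᵥ fun i => u i - v i) ^ 2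
      ≤ 8 * N / (2 * H * δ ^ (2 * H) * (N : ℝ) ^ (2 * H - 1)) ^ 2 * ∑ i, (U i + V i) := by
  have hpd := SigmaH_posDef h0 h1 hδ N
  have hN' : (0 : ℝ) < N := by exact_mod_cast hN
  set c := 2 * H * δ ^ (2 * H) * (N : ℝ) ^ (2 * H - 1)
  have hc0 : 0 < c := by positivity
  have hle := quadForm_inv_le ((Matrix.isUnit_iff_isUnit_det _).1 hpd.isUnit) hc0
    (fun a => by
      rw [dotProduct_mulVec_eq_sum]
      exact SigmaH_quadForm_lower_bound h0 h1 hδ.le a) (fun i => u i - v i)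
  have hnn : 0 ≤ (fun i => u i - v i) ⬝ᵥ (SigmaH H δ N)⁻¹ *ᵥ fun i => u i - v i := by
    simpa using hpd.inv.posSemidef.dotProduct_mulVec_nonneg fun i => u i - v i
  have h2 : (∑ i, (u i - v i) ^ 2) ^ 2 ≤ N * ∑ i, ((u i - v i) ^ 2) ^ 2 := by
    simpa using sq_sum_le_card_mul_sum_sq (s := Finset.univ) (f := fun i => (u i - v i) ^ 2)
  have h3 : ∑ i, ((u i - v i) ^ 2) ^ 2 ≤ 8 * ∑ i, (U i + V i) := by
    rw [Finset.mul_sum]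
    refine Finset.sum_le_sum fun i _ => ?_
    have h4 : ((u i - v i) ^ 2) ^ 2 ≤ 8 * (u i ^ 4 + v i ^ 4) := by
      have h5 : (u i - v i) ^ 2 ≤ 2 * (u i ^ 2 + v i ^ 2) := by
        nlinarith [sq_nonneg (u i + v i)]
      have h6 := pow_le_pow_left₀ (sq_nonneg _) h5 2
      nlinarith [sq_nonneg (u i ^ 2 - v i ^ 2)]
    linarith [hu i, hv i]
  calc ((fun i => u i - v i) ⬝ᵥ (SigmaH H δ N)⁻¹ *ᵥ fun i => u i - v i) ^ 2
      ≤ ((∑ i, (u i - v i) ^ 2) / c) ^ 2 := pow_le_pow_left₀ hnn hle 2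
    _ = (∑ i, (u i - v i) ^ 2) ^ 2 / c ^ 2 := div_pow _ _ _
    _ ≤ (N * (8 * ∑ i, (U i + V i))) / c ^ 2 := by
        gcongr
        exact h2.trans (mul_le_mul_of_nonneg_left h3 hN'.le)
    _ = 8 * N / c ^ 2 * ∑ i, (U i + V i) := by ring

theorem integral_sq_sigmaHat2_sub_le [IsProbabilityMeasure (ℙ : Measure Ω)]
    (hB : IsTwoSidedFBM H B) (h0 : 0 < H) (h1 : H ≤ 1 / 2) {σ ε δ θ : ℝ} (hε : 0 < ε)
    (hδ : 0 < δ) (hθ : 0 < θ)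
    (hInt : ∀ᵐ ω : Ω, ∀ t : ℝ,
      IntegrableOn (fun s => Real.exp (-(t - s) / ε) * |B s ω|) (Set.Iic t))
    {N : ℕ} (hN : 0 < N) :
    ∫ ω, (sigmaHat2 H σ ε δ B N ω - σ ^ 2) ^ 2
      ≤ 3 * σ ^ 4 * (2 / N + 2 * θ * (1 + 2 / N)
        + (1 + 2 / θ) * (48 * (ε ^ (4 * H) * Real.Gamma (4 * H + 1))
          / (2 * H * δ ^ (2 * H) * (N : ℝ) ^ (2 * H - 1)) ^ 2)) := by
  have hN' : (0 : ℝ) < N := by exact_mod_cast hN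
  set c := 2 * H * δ ^ (2 * H) * (N : ℝ) ^ (2 * H - 1) with hc
  have hc0 : 0 < c := by positivity
  set m := ε ^ (4 * H) * Real.Gamma (4 * H + 1)
  set S : ℝ → Ω → ℝ := fun t ω =>
    ∫ s in Set.Iic t, 1 / ε * Real.exp (-(t - s) / ε) * (B t ω - B s ω) ^ 4
  set Q : Ω → ℝ := fun ω =>
    (fun i : Fin N => B (((i : ℕ) + 1 : ℝ) * δ) ω - B ((i : ℕ) * δ) ω) ⬝ᵥ
      (SigmaH H δ N)⁻¹ *ᵥ fun i : Fin N => B (((i : ℕ) + 1 : ℝ) * δ) ω - B ((i : ℕ) * δ) ω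
    with hQ
  obtain ⟨⟨hQi, hQv⟩, hQ2i, hQ2v⟩ := quadForm_inv_moments_of_gaussian
    (Z := fun (i : Fin N) ω => B (((i : ℕ) + 1 : ℝ) * δ) ω - B ((i : ℕ) * δ) ω)
    (SigmaH_posDef h0 h1 hδ N) (hB.map_sum_grid_increments_eq hδ.le)
  have hSm := hB.expKernel_fourth_moment h0 hε
  have hSi : ∀ t, Integrable (S t) (ℙ : Measure Ω) := fun t => (hSm t).2.1
  have hSv : ∀ t, ∫ ω, S t ω = 3 * m := fun t => (hSm t).2.2
  set F : Ω → ℝ := fun ω => ∑ i : Fin N, (S (((i : ℕ) + 1 : ℝ) * δ) ω + S ((i : ℕ) * δ) ω)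
    with hF
  have hSS : ∀ i : Fin N, Integrable
      (fun ω => S (((i : ℕ) + 1 : ℝ) * δ) ω + S ((i : ℕ) * δ) ω) (ℙ : Measure Ω) :=
    fun i => (hSi _).add (hSi _)
  have hFi : Integrable F (ℙ : Measure Ω) :=
    integrable_finsetSum _ fun i _ => hSS i
  have hFv : ∫ ω, F ω = N * (6 * m) := by
    simp only [hF]
    rw [integral_finsetSum _ fun i _ => hSS i]
    simp only [integral_add (hSi _) (hSi _), hSv, Finset.sum_const, Finset.card_univ,
      Fintype.card_fin, nsmul_eq_mul]
    ring
  set g : Ω → ℝ := fun ω => 3 * σ ^ 4 * ((1 + 2 * θ) / N ^ 2 * Q ω ^ 2 - 2 / N * Q ω + 1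
    + (1 + 2 / θ) * (8 / (N * c ^ 2)) * F ω) with hg
  have i1 : Integrable (fun ω => (1 + 2 * θ) / N ^ 2 * Q ω ^ 2) (ℙ : Measure Ω) :=
    hQ2i.const_mul _
  have i2 : Integrable (fun ω => 2 / N * Q ω) (ℙ : Measure Ω) := hQi.const_mul _
  have i12 : Integrable (fun ω => (1 + 2 * θ) / N ^ 2 * Q ω ^ 2 - 2 / N * Q ω)
    (ℙ : Measure Ω) := i1.sub i2
  have i123 : Integrable (fun ω => (1 + 2 * θ) / N ^ 2 * Q ω ^ 2 - 2 / N * Q ω + 1)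
    (ℙ : Measure Ω) := i12.add (integrable_const 1)
  have i4 : Integrable (fun ω => (1 + 2 / θ) * (8 / (N * c ^ 2)) * F ω) (ℙ : Measure Ω) :=
    hFi.const_mul _
  have hgv : ∫ ω, g ω = 3 * σ ^ 4 * (2 / N + 2 * θ * (1 + 2 / N)
      + (1 + 2 / θ) * (48 * m / c ^ 2)) := by
    rw [hg, integral_const_mul, integral_add i123 i4, integral_add i12 (integrable_const 1),
      integral_sub i1 i2, integral_const_mul, integral_const_mul, integral_const_mul, hFv, hQv,
      hQ2v]
    simp only [Fintype.card_fin, integral_const, probReal_univ, smul_eq_mul, mul_one]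
    field_simp
    ring
  rw [← hgv]
  refine integral_mono_of_nonneg (ae_of_all _ fun ω => sq_nonneg _)
    ((i123.add i4).const_mul _) ?_
  have hSae : ∀ᵐ ω : Ω, ∀ k : ℕ, IntegrableOn (fun s => 1 / ε
      * Real.exp (-((k : ℝ) * δ - s) / ε) * (B (k * δ) ω - B s ω) ^ 4) (Set.Iic (k * δ)) :=
    ae_all_iff.2 fun k => (hSm _).1
  filter_upwards [hB.cont, hInt, hSae] with ω hcont hkint h4
  have hR : ∀ k : ℕ, (B (k * δ) ω - 1 / ε * ∫ s in Set.Iic (k * δ),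
      Real.exp (-(k * δ - s) / ε) * B s ω) ^ 4 ≤ S (k * δ) ω := fun k =>
    sub_expKernel_integral_pow_four_le hε hcont (hkint _) (h4 k)
  have hR' := fun k : ℕ => hR (k + 1)
  simp only [Nat.cast_add, Nat.cast_one] at hR'
  have hP := sq_quadForm_inv_increments_le h0 h1 hδ hN _ _
    (fun i : Fin N => S (((i : ℕ) + 1 : ℝ) * δ) ω) (fun i : Fin N => S ((i : ℕ) * δ) ω)
    (fun i => hR' i) (fun i => hR i)
  rw [← hc] at hP
  have hmain := sq_quadForm_inv_sub_le (SigmaH_posDef h0 h1 hδ N)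
    (fun i : Fin N => B (((i : ℕ) + 1 : ℝ) * δ) ω - B ((i : ℕ) * δ) ω)
    (fun i : Fin N => (B (((i : ℕ) + 1 : ℝ) * δ) ω - 1 / ε
      * ∫ s in Set.Iic (((i : ℕ) + 1 : ℝ) * δ),
        Real.exp (-(((i : ℕ) + 1 : ℝ) * δ - s) / ε) * B s ω)
      - (B ((i : ℕ) * δ) ω - 1 / ε * ∫ s in Set.Iic ((i : ℕ) * δ),
        Real.exp (-((i : ℕ) * δ - s) / ε) * B s ω)) σ (n := N) hθ
  have hinc : incVec H σ ε δ B N ω = fun i : Fin N =>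
      σ * ((B (((i : ℕ) + 1 : ℝ) * δ) ω - B ((i : ℕ) * δ) ω)
      - ((B (((i : ℕ) + 1 : ℝ) * δ) ω - 1 / ε
      * ∫ s in Set.Iic (((i : ℕ) + 1 : ℝ) * δ),
        Real.exp (-(((i : ℕ) + 1 : ℝ) * δ - s) / ε) * B s ω)
      - (B ((i : ℕ) * δ) ω - 1 / ε * ∫ s in Set.Iic ((i : ℕ) * δ),
        Real.exp (-((i : ℕ) * δ - s) / ε) * B s ω))) := by
    ext i
    exact slowX_sub_slowX hε hcont hkint _ _
  unfold sigmaHat2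
  rw [hinc]
  refine hmain.trans ?_
  simp only [hg]
  refine mul_le_mul_of_nonneg_left ?_ (by positivity)
  have hQω : (fun i : Fin N => B (((i : ℕ) + 1 : ℝ) * δ) ω - B ((i : ℕ) * δ) ω) ⬝ᵥ
      (SigmaH H δ N)⁻¹ *ᵥ (fun i : Fin N => B (((i : ℕ) + 1 : ℝ) * δ) ω - B ((i : ℕ) * δ) ω)
      = Q ω := rfl
  rw [hQω, mul_pow (1 / (N : ℝ)) _ 2, mul_pow (1 / (N : ℝ)) _ 2]
  have hP2 := mul_le_mul_of_nonneg_left hP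
    (by positivity : 0 ≤ (1 + 2 / θ) * (1 / (N : ℝ)) ^ 2)
  have e1 : (1 + 2 / θ) * (1 / (N : ℝ)) ^ 2 * (8 * N / c ^ 2 * F ω)
      = (1 + 2 / θ) * (8 / (N * c ^ 2)) * F ω := by
    field_simp
  have e2 : (1 / N * Q ω - 1) ^ 2 + 2 * θ * ((1 / (N : ℝ)) ^ 2 * Q ω ^ 2)
      = (1 + 2 * θ) / N ^ 2 * Q ω ^ 2 - 2 / N * Q ω + 1 := by
    field_simp
    ring
  rw [e2]
  refine add_le_add_right ?_ _
  rw [← e1, ← mul_assoc]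
  exact hP2

end Estimator

/-- Quantitative L² error bound for the MLE-type estimator in the physical fractional
Brownian motion model, case `H < 1/2`:
`‖σ̂²_{ε,δ} − σ²‖_{L²} ≤ C(ε^{2H}/δ + ε^H/δ^{1−H} + δ^{1/2})` with `δ = T/N`. -/
theorem sigmaHat2_L2_bound_of_lt_half
    {Ω : Type*} [MeasureSpace Ω] [IsProbabilityMeasure (ℙ : Measure Ω)]
    (H σ T : ℝ) (hH : H ∈ Set.Ioo (0 : ℝ) (1 / 2)) (hσ : 0 < σ) (hT : 0 < T)
    (B : ℝ → Ω → ℝ) (hB : IsTwoSidedFBM H B)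
    (hInt : ∀ ε : ℝ, 0 < ε → ∀ᵐ ω : Ω, ∀ t : ℝ,
      IntegrableOn (fun s => Real.exp (-(t - s) / ε) * |B s ω|) (Set.Iic t)) :
    ∃ C > 0, ∀ ε : ℝ, 0 < ε → ∀ N : ℕ, 0 < N →
      Real.sqrt (∫ ω, (sigmaHat2 H σ ε (T / N) B N ω - σ ^ 2) ^ 2)
        ≤ C * (ε ^ (2 * H) / (T / N) + ε ^ H / (T / N) ^ (1 - H) + Real.sqrt (T / N)) := by

  have h0 := hH.1
  have h1 := hH.2.le
  set κ := 2 * H * T ^ (2 * H - 1) with hκ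
  have hκ0 : 0 < κ := by positivity
  have hΓ : 0 < Real.Gamma (4 * H + 1) := Real.Gamma_pos_of_pos (by linarith)
  set K := 48 * Real.Gamma (4 * H + 1) / κ ^ 2 with hK
  have hK0 : 0 < K := by positivity
  set A := 3 * σ ^ 4 * (2 / T + (6 + 2 * K) * T ^ (1 - 2 * H) + K) with hA
  have hA0 : 0 < A := by positivity
  refine ⟨Real.sqrt A, Real.sqrt_pos.2 hA0, fun ε hε N hN => ?_⟩
  have hN' : (0 : ℝ) < N := by exact_mod_cast hN
  have hN1 : (1 : ℝ) ≤ N := by exact_mod_cast hN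
  set δ := T / (N : ℝ) with hδ
  have hδ0 : 0 < δ := by positivity
  have hδT : δ ≤ T := div_le_self hT.le hN1
  have hNδ : (N : ℝ) = T / δ := by
    rw [hδ]
    field_simp
  set x := ε ^ (2 * H) / δ with hx
  set y := ε ^ H / δ ^ (1 - H) with hy
  have hx0 : 0 < x := by positivity
  have hy0 : 0 < y := by positivity
  have hc : 2 * H * δ ^ (2 * H) * (N : ℝ) ^ (2 * H - 1) = κ * δ := by
    rw [hNδ, Real.div_rpow hT.le hδ0.le, Real.rpow_sub_one hδ0.ne', hκ]
    have : δ ^ (2 * H) ≠ 0 := by positivity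
    field_simp
  have hxy : x ≤ T ^ (1 - 2 * H) * y ^ 2 := by
    have e : x = δ ^ (1 - 2 * H) * y ^ 2 := by
      have hp : δ ^ ((1 - H) * ((2 : ℕ) : ℝ)) = δ ^ (1 - 2 * H) * δ := by
        rw [← Real.rpow_add_one hδ0.ne']
        congr 1
        push_cast
        ring
      have hq : 0 < δ ^ (1 - 2 * H) := by positivity
      rw [hx, hy, div_pow, ← Real.rpow_natCast, ← Real.rpow_natCast, ← Real.rpow_mul hε.le,
        ← Real.rpow_mul hδ0.le, hp, show H * ((2 : ℕ) : ℝ) = 2 * H by push_cast; ring]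
      field_simp
    rw [e]
    gcongr
    linarith
  have hmoment := integral_sq_sigmaHat2_sub_le hB h0 h1 (σ := σ) hε hδ0 hx0 (hInt ε hε) hN
  have hεx : ε ^ (4 * H) = (x * δ) ^ 2 := by
    rw [hx, div_mul_cancel₀ _ hδ0.ne', ← Real.rpow_natCast, ← Real.rpow_mul hε.le]
    congr 1
    push_cast
    ring
  have hKx : 48 * (ε ^ (4 * H) * Real.Gamma (4 * H + 1))
      / (2 * H * δ ^ (2 * H) * (N : ℝ) ^ (2 * H - 1)) ^ 2 = K * x ^ 2 := by
    rw [hc, hεx, hK]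
    field_simp
  have h2N : 2 / (N : ℝ) = 2 / T * δ := by
    rw [hδ]
    field_simp
  have h2N' : 2 / (N : ℝ) ≤ 2 := div_le_self (by norm_num) hN1
  rw [hKx] at hmoment
  have hbound : ∫ ω, (sigmaHat2 H σ ε δ B N ω - σ ^ 2) ^ 2 ≤ A * (x + y + Real.sqrt δ) ^ 2 := by
    refine hmoment.trans ?_
    rw [hA, mul_assoc (3 * σ ^ 4)]
    refine mul_le_mul_of_nonneg_left ?_ (by positivity)
    have hr0 := Real.sqrt_nonneg δ
    have hr := Real.sq_sqrt hδ0.le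
    have b1 : δ ≤ (x + y + Real.sqrt δ) ^ 2 := by
      nlinarith [mul_pos hx0 hy0, mul_nonneg hx0.le hr0, mul_nonneg hy0.le hr0]
    have b2 : x ^ 2 ≤ (x + y + Real.sqrt δ) ^ 2 := by gcongr; linarith
    have b3 : y ^ 2 ≤ (x + y + Real.sqrt δ) ^ 2 := by gcongr; linarith
    have e1 : (1 + 2 / x) * (K * x ^ 2) = K * x ^ 2 + 2 * K * x := by
      field_simp
    calc 2 / (N : ℝ) + 2 * x * (1 + 2 / N) + (1 + 2 / x) * (K * x ^ 2)
        ≤ 2 / T * δ + (6 + 2 * K) * x + K * x ^ 2 := by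
          rw [e1, ← h2N]
          nlinarith
      _ ≤ 2 / T * δ + (6 + 2 * K) * (T ^ (1 - 2 * H) * y ^ 2) + K * x ^ 2 := by gcongr
      _ ≤ 2 / T * (x + y + Real.sqrt δ) ^ 2
          + (6 + 2 * K) * (T ^ (1 - 2 * H) * (x + y + Real.sqrt δ) ^ 2)
          + K * (x + y + Real.sqrt δ) ^ 2 := by gcongr
      _ = (2 / T + (6 + 2 * K) * T ^ (1 - 2 * H) + K) * (x + y + Real.sqrt δ) ^ 2 := by ring
  calc Real.sqrt (∫ ω, (sigmaHat2 H σ ε δ B N ω - σ ^ 2) ^ 2)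
      ≤ Real.sqrt (A * (x + y + Real.sqrt δ) ^ 2) := Real.sqrt_le_sqrt hbound
    _ = Real.sqrt A * (x + y + Real.sqrt δ) := by
        rw [Real.sqrt_mul hA0.le, Real.sqrt_sq (by positivity)]
end
end

section
/- Consider the physical fractional Brownian motion model with Hurst parameter H ∈ (0,1), noise intensity σ > 0 and fixed horizon T > 0. For any fixed scale-separation parameter ε > 0, the estimator degenerates at high sampling frequency: almost surely, σ̂²_{ε,T/N} → 0 as N → ∞ (i.e. as δ = T/N → 0). -/
open MeasureTheory ProbabilityTheory Filter Matrix Topology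

noncomputable section

/-! ### Spectral representation of `|x| ^ p` and a lower bound for the increment covariance -/

lemma integrableOn_one_sub_cos_mul_rpow {p : ℝ} (h0 : 0 < p) (h2 : p < 2) :
    IntegrableOn (fun u : ℝ => (1 - Real.cos u) * u ^ (-1 - p)) (Set.Ioi 0) := by
  have hmeas : Measurable (fun u : ℝ => (1 - Real.cos u) * u ^ (-1 - p)) := by fun_prop
  rw [← Set.Ioc_union_Ioi_eq_Ioi (zero_le_one' ℝ)]
  refine IntegrableOn.union ?_ ?_
  · have hint : IntegrableOn (fun u : ℝ => u ^ (1 - p)) (Set.Ioc 0 1) := by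
      rw [← intervalIntegrable_iff_integrableOn_Ioc_of_le zero_le_one]
      exact intervalIntegral.intervalIntegrable_rpow' (by linarith)
    refine hint.mono' hmeas.aestronglyMeasurable ?_
    filter_upwards [ae_restrict_mem measurableSet_Ioc] with u hu
    have hpow : u ^ (1 - p) = u ^ 2 * u ^ (-1 - p) := by
      rw [← Real.rpow_natCast, ← Real.rpow_add hu.1]
      congr 1
      push_cast
      ring
    have hr : 0 ≤ u ^ (-1 - p) := Real.rpow_nonneg hu.1.le _
    have hc := Real.one_sub_sq_div_two_le_cos (x := u)
    have hc1 := Real.cos_le_one u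
    rw [Real.norm_eq_abs, abs_of_nonneg (mul_nonneg (by linarith) hr), hpow]
    exact mul_le_mul_of_nonneg_right (by nlinarith [sq_nonneg u]) hr
  · have hint : IntegrableOn (fun u : ℝ => 2 * u ^ (-1 - p)) (Set.Ioi 1) :=
      (integrableOn_Ioi_rpow_of_lt (by linarith) zero_lt_one).const_mul 2
    refine hint.mono' hmeas.aestronglyMeasurable ?_
    filter_upwards [ae_restrict_mem measurableSet_Ioi] with u hu
    have hr : 0 ≤ u ^ (-1 - p) := Real.rpow_nonneg (zero_le_one.trans hu.le) _
    have hc := Real.neg_one_le_cos u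
    have hc1 := Real.cos_le_one u
    rw [Real.norm_eq_abs, abs_of_nonneg (mul_nonneg (by linarith) hr)]
    exact mul_le_mul_of_nonneg_right (by linarith) hr

/-- The normalising constant in the spectral representation of `|x| ^ p`. -/
def spectralConst (p : ℝ) : ℝ := ∫ u in Set.Ioi (0 : ℝ), (1 - Real.cos u) * u ^ (-1 - p)

lemma one_sub_cos_mul_rpow_comp {p x u : ℝ} (hx : x ≠ 0) (hu : 0 < u) :
    (1 - Real.cos (x * u)) * u ^ (-1 - p) =
      |x| ^ (1 + p) * ((1 - Real.cos (|x| * u)) * (|x| * u) ^ (-1 - p)) := by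
  have hx' : 0 < |x| := abs_pos.mpr hx
  have hcos : Real.cos (|x| * u) = Real.cos (x * u) := by
    rw [← Real.cos_abs (x * u), abs_mul, abs_of_pos hu]
  have hpow : |x| ^ (1 + p) * |x| ^ (-1 - p) = 1 := by
    rw [← Real.rpow_add hx']
    simp
  rw [hcos, Real.mul_rpow hx'.le hu.le]
  linear_combination -(1 - Real.cos (x * u)) * u ^ (-1 - p) * hpow

lemma integrableOn_one_sub_cos_mul {p : ℝ} (h0 : 0 < p) (h2 : p < 2) (x : ℝ) :
    IntegrableOn (fun u : ℝ => (1 - Real.cos (x * u)) * u ^ (-1 - p)) (Set.Ioi 0) := by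
  rcases eq_or_ne x 0 with rfl | hx
  · simp
  · have hi : IntegrableOn
        (fun u : ℝ => (1 - Real.cos (|x| * u)) * (|x| * u) ^ (-1 - p)) (Set.Ioi 0) := by
      have := (integrableOn_Ioi_comp_mul_left_iff
        (fun u : ℝ => (1 - Real.cos u) * u ^ (-1 - p)) 0 (abs_pos.mpr hx)).mpr
        (by simpa using integrableOn_one_sub_cos_mul_rpow h0 h2)
      exact this
    exact (IntegrableOn.congr_fun (hi.const_mul (|x| ^ (1 + p)))
      (fun u hu => (one_sub_cos_mul_rpow_comp hx hu).symm) measurableSet_Ioi)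

lemma integral_one_sub_cos_mul {p : ℝ} (h0 : 0 < p) (x : ℝ) :
    ∫ u in Set.Ioi (0 : ℝ), (1 - Real.cos (x * u)) * u ^ (-1 - p) =
      spectralConst p * |x| ^ p := by
  rcases eq_or_ne x 0 with rfl | hx
  · simp [Real.zero_rpow h0.ne']
  · have hx' : 0 < |x| := abs_pos.mpr hx
    rw [setIntegral_congr_fun measurableSet_Ioi
      (fun u hu => one_sub_cos_mul_rpow_comp (p := p) hx hu), integral_const_mul,
      integral_comp_mul_left_Ioi (fun u : ℝ => (1 - Real.cos u) * u ^ (-1 - p)) 0 hx']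
    rw [mul_zero, smul_eq_mul, Real.rpow_add hx', Real.rpow_one, spectralConst]
    field_simp

lemma two_div_pi_sq_mul_rpow_le {p u : ℝ} (hu : 0 < u) (hπ : u ≤ Real.pi) :
    2 / Real.pi ^ 2 * u ^ (1 - p) ≤ (1 - Real.cos u) * u ^ (-1 - p) := by
  have hpow : u ^ (1 - p) = u ^ 2 * u ^ (-1 - p) := by
    rw [← Real.rpow_natCast, ← Real.rpow_add hu]
    congr 1
    push_cast
    ring
  have hc : Real.cos u ≤ 1 - 2 / Real.pi ^ 2 * u ^ 2 :=
    Real.cos_le_one_sub_mul_cos_sq (by rwa [abs_of_pos hu])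
  rw [hpow, ← mul_assoc]
  exact mul_le_mul_of_nonneg_right (by linarith) (Real.rpow_nonneg hu.le _)

lemma spectralConst_pos {p : ℝ} (h0 : 0 < p) (h2 : p < 2) : 0 < spectralConst p := by
  have hnn : ∀ u ∈ Set.Ioi (0 : ℝ), 0 ≤ (1 - Real.cos u) * u ^ (-1 - p) := fun u hu =>
    mul_nonneg (by linarith [Real.cos_le_one u]) (Real.rpow_nonneg (le_of_lt hu) _)
  have hi := integrableOn_one_sub_cos_mul_rpow h0 h2
  have hsub : Set.Ioc (0 : ℝ) 1 ⊆ Set.Ioi 0 := fun u hu => hu.1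
  have h1 : ∫ u in Set.Ioc (0 : ℝ) 1, 2 / Real.pi ^ 2 * u ^ (1 - p) ≤ spectralConst p := by
    refine le_trans (setIntegral_mono_on ?_ (hi.mono_set hsub) measurableSet_Ioc fun u hu =>
      two_div_pi_sq_mul_rpow_le hu.1 (by linarith [hu.2, Real.pi_gt_three]))
      (setIntegral_mono_set hi ?_ hsub.eventuallyLE)
    · refine Integrable.const_mul ?_ _
      have := intervalIntegral.intervalIntegrable_rpow' (a := 0) (b := 1) (r := 1 - p)
        (by linarith)
      rwa [intervalIntegrable_iff_integrableOn_Ioc_of_le zero_le_one] at this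
    · filter_upwards [ae_restrict_mem measurableSet_Ioi] with u hu using hnn u hu
  refine lt_of_lt_of_le ?_ h1
  rw [← intervalIntegral.integral_of_le zero_le_one, intervalIntegral.integral_const_mul,
    integral_rpow (Or.inl (by linarith))]
  rw [Real.one_rpow, Real.zero_rpow (by linarith)]
  have : 0 < 1 - p + 1 := by linarith
  have := Real.pi_pos
  positivity

/-- The squared modulus of the trigonometric polynomial with coefficients `x`. -/
def trigSq {N : ℕ} (x : Fin N → ℝ) (u : ℝ) : ℝ :=
  ∑ i, ∑ j, x i * x j * Real.cos (((i : ℝ) - (j : ℝ)) * u)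

lemma trigSq_eq {N : ℕ} (x : Fin N → ℝ) (u : ℝ) :
    trigSq x u = (∑ i, x i * Real.cos (i * u)) ^ 2 + (∑ i, x i * Real.sin (i * u)) ^ 2 := by
  rw [sq, sq, Finset.sum_mul_sum, Finset.sum_mul_sum, ← Finset.sum_add_distrib, trigSq]
  refine Finset.sum_congr rfl fun i _ => ?_
  rw [← Finset.sum_add_distrib]
  refine Finset.sum_congr rfl fun j _ => ?_
  rw [sub_mul, Real.cos_sub]
  ring

lemma trigSq_nonneg {N : ℕ} (x : Fin N → ℝ) (u : ℝ) : 0 ≤ trigSq x u := by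
  rw [trigSq_eq]
  positivity

lemma continuous_trigSq {N : ℕ} (x : Fin N → ℝ) : Continuous (trigSq x) := by
  unfold trigSq
  fun_prop

lemma trigSq_le {N : ℕ} (x : Fin N → ℝ) (u : ℝ) : trigSq x u ≤ N * ∑ i, x i ^ 2 := by
  have h1 := Finset.sum_mul_sq_le_sq_mul_sq Finset.univ x (fun i : Fin N => Real.cos (i * u))
  have h2 := Finset.sum_mul_sq_le_sq_mul_sq Finset.univ x (fun i : Fin N => Real.sin (i * u))
  have h3 : ∑ i : Fin N, Real.cos (i * u) ^ 2 + ∑ i : Fin N, Real.sin (i * u) ^ 2 = N := by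
    rw [← Finset.sum_add_distrib]
    simp
  rw [trigSq_eq, ← h3]
  linarith

lemma integral_cos_int_mul_zero_pi {N : ℕ} (i j : Fin N) :
    ∫ u in (0 : ℝ)..Real.pi, Real.cos (((i : ℝ) - (j : ℝ)) * u) =
      if i = j then Real.pi else 0 := by
  split_ifs with h
  · simp [h]
  · have hne : (i : ℝ) - (j : ℝ) ≠ 0 := by
      rw [sub_ne_zero]
      exact_mod_cast fun h' => h (Fin.ext h')
    rw [intervalIntegral.integral_comp_mul_left (fun u => Real.cos u) hne, integral_cos]
    have := Real.sin_int_mul_pi ((i : ℤ) - (j : ℤ))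
    push_cast at this
    rw [this]
    simp

lemma integral_trigSq {N : ℕ} (x : Fin N → ℝ) :
    ∫ u in (0 : ℝ)..Real.pi, trigSq x u = Real.pi * ∑ i, x i ^ 2 := by
  unfold trigSq
  rw [intervalIntegral.integral_finsetSum
    fun i _ => Continuous.intervalIntegrable (by fun_prop) _ _]
  rw [Finset.mul_sum]
  refine Finset.sum_congr rfl fun i _ => ?_
  rw [intervalIntegral.integral_finsetSum
    fun j _ => Continuous.intervalIntegrable (by fun_prop) _ _]
  simp only [intervalIntegral.integral_const_mul, integral_cos_int_mul_zero_pi]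
  simp
  ring

lemma sum_sq_le_integral_trigSq {N : ℕ} (hN : 0 < N) (x : Fin N → ℝ) :
    ∑ i, x i ^ 2 ≤ ∫ u in (1 / (N : ℝ))..Real.pi, trigSq x u := by
  have hN' : (0 : ℝ) < N := by exact_mod_cast hN
  have hint : ∀ a b, IntervalIntegrable (trigSq x) volume a b :=
    fun a b => (continuous_trigSq x).intervalIntegrable a b
  have hadd := intervalIntegral.integral_add_adjacent_intervals
    (hint 0 (1 / N)) (hint (1 / N) Real.pi)
  have hle : ∫ u in (0 : ℝ)..(1 / N), trigSq x u ≤ ∫ u in (0 : ℝ)..(1 / N), N * ∑ i, x i ^ 2 :=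
    intervalIntegral.integral_mono (by positivity) (hint _ _) (by simp) (trigSq_le x)
  rw [intervalIntegral.integral_const, smul_eq_mul, sub_zero, ← mul_assoc,
    one_div_mul_cancel hN'.ne', one_mul] at hle
  rw [integral_trigSq] at hadd
  have hs : 0 ≤ ∑ i, x i ^ 2 := Finset.sum_nonneg fun i _ => sq_nonneg _
  nlinarith [Real.pi_gt_three]

lemma cos_mul_one_sub_cos (k u : ℝ) :
    Real.cos (k * u) * (1 - Real.cos u) =
      ((1 - Real.cos ((k + 1) * u)) + (1 - Real.cos ((k - 1) * u))
        - 2 * (1 - Real.cos (k * u))) / 2 := by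
  rw [add_mul, sub_mul, one_mul, Real.cos_add, Real.cos_sub]
  ring

lemma cos_mul_spectral_eq (p k : ℝ) :
    (fun u : ℝ => Real.cos (k * u) * ((1 - Real.cos u) * u ^ (-1 - p))) = fun u : ℝ =>
      ((1 - Real.cos ((k + 1) * u)) * u ^ (-1 - p) + (1 - Real.cos ((k - 1) * u)) * u ^ (-1 - p)
        - 2 * ((1 - Real.cos (k * u)) * u ^ (-1 - p))) / 2 := by
  funext u
  rw [← mul_assoc, cos_mul_one_sub_cos]
  ring

lemma integrableOn_cos_mul_spectral {p : ℝ} (h0 : 0 < p) (h2 : p < 2) (k : ℝ) :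
    IntegrableOn (fun u : ℝ => Real.cos (k * u) * ((1 - Real.cos u) * u ^ (-1 - p)))
      (Set.Ioi 0) := by
  have h := fun y => integrableOn_one_sub_cos_mul h0 h2 y
  rw [cos_mul_spectral_eq]
  exact (((h (k + 1)).add (h (k - 1))).sub ((h k).const_mul 2)).div_const 2

lemma integral_cos_mul_spectral {p : ℝ} (h0 : 0 < p) (h2 : p < 2) (k : ℝ) :
    ∫ u in Set.Ioi (0 : ℝ), Real.cos (k * u) * ((1 - Real.cos u) * u ^ (-1 - p)) =
      spectralConst p * ((|k + 1| ^ p + |k - 1| ^ p - 2 * |k| ^ p) / 2) := by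
  have h := fun y => integrableOn_one_sub_cos_mul h0 h2 y
  have hadd : IntegrableOn (fun u : ℝ => (1 - Real.cos ((k + 1) * u)) * u ^ (-1 - p) +
      (1 - Real.cos ((k - 1) * u)) * u ^ (-1 - p)) (Set.Ioi 0) := (h (k + 1)).add (h (k - 1))
  rw [cos_mul_spectral_eq, integral_div, integral_sub hadd ((h k).const_mul 2),
    integral_add (h (k + 1)) (h (k - 1)), integral_const_mul]
  simp only [integral_one_sub_cos_mul h0]
  ring

lemma dotProduct_SigmaH_mulVec {H δ : ℝ} (h0 : 0 < H) (h1 : H < 1) {N : ℕ} (x : Fin N → ℝ) :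
    spectralConst (2 * H) * (x ⬝ᵥ (SigmaH H δ N *ᵥ x)) =
      δ ^ (2 * H) * ∫ u in Set.Ioi (0 : ℝ),
        trigSq x u * ((1 - Real.cos u) * u ^ (-1 - 2 * H)) := by
  have hi : ∀ i j : Fin N, IntegrableOn (fun u : ℝ => x i * x j *
      (Real.cos (((i : ℝ) - (j : ℝ)) * u) * ((1 - Real.cos u) * u ^ (-1 - 2 * H))))
      (Set.Ioi 0) := fun i j =>
    (integrableOn_cos_mul_spectral (by linarith) (by linarith) _).const_mul _
  have hfun : (fun u : ℝ => trigSq x u * ((1 - Real.cos u) * u ^ (-1 - 2 * H))) =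
      fun u : ℝ => ∑ i, ∑ j, x i * x j *
        (Real.cos (((i : ℝ) - (j : ℝ)) * u) * ((1 - Real.cos u) * u ^ (-1 - 2 * H))) := by
    funext u
    simp only [trigSq, Finset.sum_mul, mul_assoc]
  rw [hfun, integral_finsetSum _ fun i _ => integrable_finsetSum _ fun j _ => hi i j]
  simp only [integral_finsetSum _ fun j _ => hi _ j, integral_const_mul,
    integral_cos_mul_spectral (p := 2 * H) (by linarith) (by linarith)]
  simp only [dotProduct, mulVec, SigmaH, Finset.mul_sum]
  refine Finset.sum_congr rfl fun i _ => Finset.sum_congr rfl fun j _ => ?_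
  ring

lemma integrableOn_trigSq_mul {p : ℝ} (h0 : 0 < p) (h2 : p < 2) {N : ℕ} (x : Fin N → ℝ) :
    IntegrableOn (fun u : ℝ => trigSq x u * ((1 - Real.cos u) * u ^ (-1 - p))) (Set.Ioi 0) := by
  simp only [trigSq, Finset.sum_mul, mul_assoc]
  refine integrable_finsetSum _ fun i _ => integrable_finsetSum _ fun j _ => ?_
  exact ((integrableOn_cos_mul_spectral h0 h2 _).const_mul _).const_mul _

lemma rpow_le_of_mem_Ioc {p u : ℝ} {N : ℕ} (hN : 0 < N) (hu : 1 / (N : ℝ) < u)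
    (hπ : u ≤ Real.pi) : u ^ (p - 1) ≤ Real.pi ^ (p - 1) + (N : ℝ) ^ (1 - p) := by
  have hN' : (0 : ℝ) < N := by exact_mod_cast hN
  have hu0 : 0 < u := lt_trans (by positivity) hu
  have hA : 0 ≤ Real.pi ^ (p - 1) := Real.rpow_nonneg Real.pi_pos.le _
  have hB : 0 ≤ (N : ℝ) ^ (1 - p) := Real.rpow_nonneg hN'.le _
  rcases le_total 1 p with h | h
  · linarith [Real.rpow_le_rpow hu0.le hπ (sub_nonneg.mpr h)]
  · have h1 : u ^ (p - 1) ≤ (1 / (N : ℝ)) ^ (p - 1) :=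
      Real.rpow_le_rpow_of_nonpos (by positivity) hu.le (by linarith)
    have h2 : (1 / (N : ℝ)) ^ (p - 1) = (N : ℝ) ^ (1 - p) := by
      rw [one_div, Real.inv_rpow hN'.le, ← Real.rpow_neg hN'.le, neg_sub]
    linarith

lemma sum_sq_le_integral_trigSq_mul {p : ℝ} (h0 : 0 < p) (h2 : p < 2) {N : ℕ} (hN : 0 < N)
    (x : Fin N → ℝ) :
    2 / Real.pi ^ 2 * ∑ i, x i ^ 2 ≤ (Real.pi ^ (p - 1) + (N : ℝ) ^ (1 - p)) *
      ∫ u in Set.Ioi (0 : ℝ), trigSq x u * ((1 - Real.cos u) * u ^ (-1 - p)) := by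
  have hN' : (1 : ℝ) ≤ N := by exact_mod_cast hN
  have hN0 : (0 : ℝ) < N := by linarith
  set K : ℝ := Real.pi ^ (p - 1) + (N : ℝ) ^ (1 - p) with hK
  have hK0 : 0 < K := add_pos (Real.rpow_pos_of_pos Real.pi_pos _) (Real.rpow_pos_of_pos hN0 _)
  have hle : 1 / (N : ℝ) ≤ Real.pi := by
    have : 1 / (N : ℝ) ≤ 1 := by rw [div_le_one hN0]; exact hN'
    linarith [Real.pi_gt_three]
  have hsub : Set.Ioc (1 / (N : ℝ)) Real.pi ⊆ Set.Ioi 0 := fun u hu =>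
    lt_trans (by positivity) hu.1
  have hi := integrableOn_trigSq_mul h0 h2 x
  have hic : IntegrableOn (trigSq x) (Set.Ioc (1 / (N : ℝ)) Real.pi) :=
    ((continuous_trigSq x).integrableOn_Icc).mono_set Set.Ioc_subset_Icc_self
  rw [← integral_const_mul]
  calc 2 / Real.pi ^ 2 * ∑ i, x i ^ 2
      ≤ 2 / Real.pi ^ 2 * ∫ u in (1 / (N : ℝ))..Real.pi, trigSq x u :=
        mul_le_mul_of_nonneg_left (sum_sq_le_integral_trigSq hN x) (by positivity)
    _ = ∫ u in Set.Ioc (1 / (N : ℝ)) Real.pi, 2 / Real.pi ^ 2 * trigSq x u := by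
        rw [intervalIntegral.integral_of_le hle, integral_const_mul]
    _ ≤ ∫ u in Set.Ioc (1 / (N : ℝ)) Real.pi,
          K * (trigSq x u * ((1 - Real.cos u) * u ^ (-1 - p))) := by
        refine setIntegral_mono_on (hic.const_mul _) ((hi.mono_set hsub).const_mul _)
          measurableSet_Ioc fun u hu => ?_
        have hu0 : 0 < u := hsub hu
        have hw := two_div_pi_sq_mul_rpow_le (p := p) hu0 hu.2
        have hr : u ^ (p - 1) * u ^ (1 - p) = 1 := by
          rw [← Real.rpow_add hu0]
          simp
        have hone : 1 ≤ K * u ^ (1 - p) := by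
          refine hr.symm.trans_le ?_
          exact mul_le_mul_of_nonneg_right (rpow_le_of_mem_Ioc hN hu.1 hu.2)
            (Real.rpow_nonneg hu0.le _)
        have hpi : 0 < 2 / Real.pi ^ 2 := by positivity
        have : 2 / Real.pi ^ 2 ≤ K * ((1 - Real.cos u) * u ^ (-1 - p)) := by
          calc 2 / Real.pi ^ 2 ≤ 2 / Real.pi ^ 2 * (K * u ^ (1 - p)) :=
                le_mul_of_one_le_right hpi.le hone
            _ = K * (2 / Real.pi ^ 2 * u ^ (1 - p)) := by ring
            _ ≤ _ := mul_le_mul_of_nonneg_left hw hK0.le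
        calc 2 / Real.pi ^ 2 * trigSq x u
            ≤ K * ((1 - Real.cos u) * u ^ (-1 - p)) * trigSq x u :=
              mul_le_mul_of_nonneg_right this (trigSq_nonneg x u)
          _ = _ := by ring
    _ ≤ _ := by
        refine setIntegral_mono_set (hi.const_mul _) ?_ hsub.eventuallyLE
        filter_upwards [ae_restrict_mem measurableSet_Ioi] with u hu
        exact mul_nonneg hK0.le (mul_nonneg (trigSq_nonneg x u) (mul_nonneg
          (by linarith [Real.cos_le_one u]) (Real.rpow_nonneg (le_of_lt hu) _)))

/-- Quantitative positive definiteness of the covariance matrix of the fBm increments. -/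
lemma sum_sq_le_dotProduct_SigmaH {H δ : ℝ} (h0 : 0 < H) (h1 : H < 1) (hδ : 0 < δ) {N : ℕ}
    (hN : 0 < N) (x : Fin N → ℝ) :
    2 / Real.pi ^ 2 * δ ^ (2 * H) / (spectralConst (2 * H) *
        (Real.pi ^ (2 * H - 1) + (N : ℝ) ^ (1 - 2 * H))) * ∑ i, x i ^ 2
      ≤ x ⬝ᵥ (SigmaH H δ N *ᵥ x) := by
  have hN0 : (0 : ℝ) < N := by exact_mod_cast hN
  have hC := spectralConst_pos (p := 2 * H) (by linarith) (by linarith)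
  have hK : 0 < Real.pi ^ (2 * H - 1) + (N : ℝ) ^ (1 - 2 * H) :=
    add_pos (Real.rpow_pos_of_pos Real.pi_pos _) (Real.rpow_pos_of_pos hN0 _)
  have hd : 0 < δ ^ (2 * H) := Real.rpow_pos_of_pos hδ _
  have hq := dotProduct_SigmaH_mulVec (δ := δ) h0 h1 x
  have hb := mul_le_mul_of_nonneg_left
    (sum_sq_le_integral_trigSq_mul (p := 2 * H) (by linarith) (by linarith) hN x) hd.le
  rw [div_mul_eq_mul_div, div_le_iff₀ (mul_pos hC hK)]
  calc _ = δ ^ (2 * H) * (2 / Real.pi ^ 2 * ∑ i, x i ^ 2) := by ring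
    _ ≤ _ := hb
    _ = (Real.pi ^ (2 * H - 1) + (N : ℝ) ^ (1 - 2 * H)) * (spectralConst (2 * H) *
          (x ⬝ᵥ (SigmaH H δ N *ᵥ x))) := by rw [hq]; ring
    _ = _ := by ring

/-! ### Bounding an inverse quadratic form -/

lemma dotProduct_inv_mulVec_mem_Icc {n : Type*} [Fintype n] [DecidableEq n] (A : Matrix n n ℝ)
    {l : ℝ} (hl : 0 < l) (hA : ∀ x : n → ℝ, l * ∑ i, x i ^ 2 ≤ x ⬝ᵥ (A *ᵥ x)) (v : n → ℝ) :
    v ⬝ᵥ (A⁻¹ *ᵥ v) ∈ Set.Icc 0 ((∑ i, v i ^ 2) / l) := by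
  have hinj : Function.Injective A.mulVec := by
    intro x y hxy
    have h := hA (x - y)
    rw [mulVec_sub, show A *ᵥ x = A *ᵥ y from hxy, sub_self, dotProduct_zero] at h
    have hs : ∑ i, (x - y) i ^ 2 = 0 :=
      le_antisymm (by nlinarith) (Finset.sum_nonneg fun i _ => sq_nonneg _)
    rw [Finset.sum_eq_zero_iff_of_nonneg fun i _ => sq_nonneg _] at hs
    funext i
    have := hs i (Finset.mem_univ i)
    simpa [sub_eq_zero] using this
  have hu : IsUnit A.det := (isUnit_iff_isUnit_det A).mp (mulVec_injective_iff_isUnit.mp hinj)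
  set w := A⁻¹ *ᵥ v with hw
  have hv : A *ᵥ w = v := by rw [hw, mulVec_mulVec, mul_nonsing_inv A hu, one_mulVec]
  have hq := hA w
  rw [hv, dotProduct_comm] at hq
  have hw0 : 0 ≤ ∑ i, w i ^ 2 := Finset.sum_nonneg fun i _ => sq_nonneg _
  refine ⟨le_trans (mul_nonneg hl.le hw0) hq, ?_⟩
  have hyoung : 2 * (v ⬝ᵥ w) ≤ (∑ i, v i ^ 2) / l + l * ∑ i, w i ^ 2 := by
    rw [dotProduct, Finset.mul_sum, Finset.sum_div, Finset.mul_sum, ← Finset.sum_add_distrib]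
    refine Finset.sum_le_sum fun i _ => ?_
    have : v i ^ 2 / l + l * w i ^ 2 - 2 * (v i * w i) = (v i - l * w i) ^ 2 / l := by
      field_simp
      ring
    have h' : 0 ≤ (v i - l * w i) ^ 2 / l := by positivity
    linarith
  linarith

/-! ### Regularity of the slow component -/

lemma continuous_integral_Iic_exp_mul {ε : ℝ} {b : ℝ → ℝ} (hb : Continuous b)
    (hint : ∀ t : ℝ, IntegrableOn (fun s => Real.exp (-(t - s) / ε) * |b s|) (Set.Iic t)) :
    Continuous fun t => ∫ s in Set.Iic t, Real.exp (-(t - s) / ε) * b s := by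
  have hsplit : ∀ t s : ℝ, Real.exp (-(t - s) / ε) = Real.exp (-t / ε) * Real.exp (s / ε) := by
    intro t s
    rw [← Real.exp_add]
    congr 1
    ring
  have hcont : Continuous fun s => Real.exp (s / ε) * b s := by fun_prop
  have hI : ∀ t, IntegrableOn (fun s => Real.exp (s / ε) * b s) (Set.Iic t) := by
    intro t
    refine ((hint t).const_mul (Real.exp (t / ε))).mono' hcont.aestronglyMeasurable
      (ae_of_all _ fun s => ?_)
    rw [norm_mul, Real.norm_eq_abs, Real.norm_eq_abs, Real.abs_exp, hsplit, ← mul_assoc,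
      ← mul_assoc, ← Real.exp_add]
    simp [neg_div]
  have heq : (fun t => ∫ s in Set.Iic t, Real.exp (-(t - s) / ε) * b s) = fun t =>
      Real.exp (-t / ε) * ((∫ s in Set.Iic (0 : ℝ), Real.exp (s / ε) * b s) +
        ∫ s in (0 : ℝ)..t, Real.exp (s / ε) * b s) := by
    funext t
    rw [← intervalIntegral.integral_Iic_sub_Iic (hI 0) (hI t), add_sub_cancel,
      ← integral_const_mul]
    simp only [hsplit, mul_assoc]
  rw [heq]
  have := intervalIntegral.continuous_primitive
    (fun a c => hcont.intervalIntegrable (μ := volume) a c) 0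
  fun_prop

lemma exists_abs_incVec_le {Ω : Type*} [MeasureSpace Ω] {H σ ε T : ℝ} {B : ℝ → Ω → ℝ} {ω : Ω}
    (hT : 0 < T) (hcont : Continuous fun t => fracOU H σ ε B t ω) :
    ∃ M : ℝ, ∀ (N : ℕ), 0 < N → ∀ k : Fin N,
      incVec H σ ε (T / N) B N ω k ^ 2 ≤ M * (T / N) ^ 2 := by
  obtain ⟨R, hR⟩ := (isCompact_Icc (a := (0 : ℝ)) (b := T)).exists_bound_of_continuousOn
    hcont.continuousOn
  refine ⟨(ε ^ (H - 1) * R) ^ 2, fun N hN k => ?_⟩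
  have hN0 : (0 : ℝ) < N := by exact_mod_cast hN
  have hk : ((k : ℕ) : ℝ) + 1 ≤ N := by exact_mod_cast k.2
  have hδ : 0 < T / N := by positivity
  have hend : (((k : ℕ) : ℝ) + 1) * (T / N) ≤ T := by
    calc _ ≤ (N : ℝ) * (T / N) := mul_le_mul_of_nonneg_right hk hδ.le
      _ = T := by field_simp
  have hint : ∀ a c, IntervalIntegrable (fun t => fracOU H σ ε B t ω) volume a c :=
    fun a c => hcont.intervalIntegrable a c
  have hinc : incVec H σ ε (T / N) B N ω k = ε ^ (H - 1) *
      ∫ s in (((k : ℕ) : ℝ) * (T / N))..((((k : ℕ) : ℝ) + 1) * (T / N)),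
        fracOU H σ ε B s ω := by
    rw [incVec, slowX, slowX, ← mul_sub,
      intervalIntegral.integral_interval_sub_left (hint _ _) (hint _ _)]
  have hbd := intervalIntegral.norm_integral_le_of_norm_le_const
    (a := ((k : ℕ) : ℝ) * (T / N)) (b := (((k : ℕ) : ℝ) + 1) * (T / N)) (C := R)
    (f := fun s => fracOU H σ ε B s ω) (fun s hs => by
      rw [Set.uIoc_of_le (by nlinarith)] at hs
      exact hR s ⟨le_trans (by positivity) hs.1.le, hs.2.trans hend⟩)
  rw [show (((k : ℕ) : ℝ) + 1) * (T / N) - (k : ℕ) * (T / N) = T / N by ring,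
    abs_of_pos hδ, Real.norm_eq_abs] at hbd
  have hsq := sq_le_sq' (abs_le.mp hbd).1 (abs_le.mp hbd).2
  rw [hinc, mul_pow]
  calc _ ≤ (ε ^ (H - 1)) ^ 2 * (R * (T / N)) ^ 2 := mul_le_mul_of_nonneg_left hsq (sq_nonneg _)
    _ = _ := by ring

lemma tendsto_zero_of_rate {H T : ℝ} (h1 : H < 1) (D : ℝ) (hT : 0 < T) :
    Tendsto (fun N : ℕ => D * (T / N) ^ 2 / (T / N) ^ (2 * H) *
      (Real.pi ^ (2 * H - 1) + (N : ℝ) ^ (1 - 2 * H))) atTop (𝓝 0) := by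
  have ha : Tendsto (fun N : ℕ => (N : ℝ) ^ (-(2 - 2 * H))) atTop (𝓝 0) :=
    (tendsto_rpow_neg_atTop (by linarith)).comp tendsto_natCast_atTop_atTop
  have hb : Tendsto (fun N : ℕ => (N : ℝ) ^ (-(1 : ℝ))) atTop (𝓝 0) :=
    (tendsto_rpow_neg_atTop one_pos).comp tendsto_natCast_atTop_atTop
  have h := ((ha.const_mul (Real.pi ^ (2 * H - 1))).add hb).const_mul (D * T ^ (2 - 2 * H))
  simp only [mul_zero, add_zero] at h
  refine h.congr' ?_
  filter_upwards [eventually_gt_atTop 0] with N hN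
  have hN0 : (0 : ℝ) < N := by exact_mod_cast hN
  have hδ : 0 < T / N := by positivity
  have e1 : (T / N) ^ 2 / (T / N) ^ (2 * H) = T ^ (2 - 2 * H) * (N : ℝ) ^ (-(2 - 2 * H)) := by
    rw [← Real.rpow_natCast, ← Real.rpow_sub hδ, Real.div_rpow hT.le hN0.le,
      Real.rpow_neg hN0.le]
    push_cast
    ring
  have e2 : (N : ℝ) ^ (-(1 : ℝ)) = (N : ℝ) ^ (-(2 - 2 * H)) * (N : ℝ) ^ (1 - 2 * H) := by
    rw [← Real.rpow_add hN0]
    congr 1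
    ring
  rw [mul_div_assoc, e1, e2]
  ring

/-- Degeneracy at high frequency: for fixed `ε > 0`, almost surely
`σ̂²_{ε,T/N} → 0` as `N → ∞`. -/
theorem sigmaHat2_degenerate_fixed_eps
    {Ω : Type*} [MeasureSpace Ω] [IsProbabilityMeasure (ℙ : Measure Ω)]
    (H σ T ε : ℝ) (hH : H ∈ Set.Ioo (0 : ℝ) 1) (hσ : 0 < σ) (hT : 0 < T) (hε : 0 < ε)
    (B : ℝ → Ω → ℝ) (hB : IsTwoSidedFBM H B)
    (hInt : ∀ᵐ ω : Ω, ∀ t : ℝ,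
      IntegrableOn (fun s => Real.exp (-(t - s) / ε) * |B s ω|) (Set.Iic t)) :
    ∀ᵐ ω : Ω, Tendsto (fun N : ℕ => sigmaHat2 H σ ε (T / N) B N ω) atTop (𝓝 0) := by
  filter_upwards [hB.cont, hInt] with ω hcont hint
  obtain ⟨hH0, hH1⟩ := hH
  have hY : Continuous fun t => fracOU H σ ε B t ω := by
    have := continuous_integral_Iic_exp_mul hcont hint
    unfold fracOU
    fun_prop
  obtain ⟨M, hM⟩ := exists_abs_incVec_le hT hY
  have hC := spectralConst_pos (p := 2 * H) (by linarith) (by linarith)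
  refine squeeze_zero' (g := fun N : ℕ => M * (spectralConst (2 * H) * (Real.pi ^ 2 / 2)) *
    (T / N) ^ 2 / (T / N) ^ (2 * H) * (Real.pi ^ (2 * H - 1) + (N : ℝ) ^ (1 - 2 * H))) ?_ ?_
    (tendsto_zero_of_rate hH1 _ hT)
  all_goals
    filter_upwards [eventually_gt_atTop 0] with N hN
    have hN0 : (0 : ℝ) < N := by exact_mod_cast hN
    have hδ : 0 < T / N := by positivity
    have hd : 0 < (T / N) ^ (2 * H) := Real.rpow_pos_of_pos hδ _
    have hK : 0 < Real.pi ^ (2 * H - 1) + (N : ℝ) ^ (1 - 2 * H) :=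
      add_pos (Real.rpow_pos_of_pos Real.pi_pos _) (Real.rpow_pos_of_pos hN0 _)
    have hl : 0 < 2 / Real.pi ^ 2 * (T / N) ^ (2 * H) / (spectralConst (2 * H) *
        (Real.pi ^ (2 * H - 1) + (N : ℝ) ^ (1 - 2 * H))) := by positivity
    have hmem := dotProduct_inv_mulVec_mem_Icc (SigmaH H (T / N) N) hl
      (sum_sq_le_dotProduct_SigmaH hH0 hH1 hδ hN) (incVec H σ ε (T / N) B N ω)
    rw [sigmaHat2]
  · exact mul_nonneg (by positivity) hmem.1
  · have hsum : ∑ k, incVec H σ ε (T / N) B N ω k ^ 2 ≤ N * (M * (T / N) ^ 2) := by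
      refine (Finset.sum_le_sum fun k _ => hM N hN k).trans_eq ?_
      simp
    calc _ ≤ 1 / (N : ℝ) * ((N * (M * (T / N) ^ 2)) / _) :=
          mul_le_mul_of_nonneg_left
            (hmem.2.trans (div_le_div_of_nonneg_right hsum hl.le)) (by positivity)
      _ = _ := by
          generalize (T / (N : ℝ)) ^ (2 * H) = d at *
          generalize Real.pi ^ (2 * H - 1) + (N : ℝ) ^ (1 - 2 * H) = K at *
          have := Real.pi_pos
          field_simp
end
end
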